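/- Let M be a right R-module, let F ⊆ U(M^∞) satisfy the chain condition, let X ⊆ M^∞ be a subset, and let d be an integer. Assume that for every sequence (v_1,…,v_m) ∈ F \ O(X) the poset O(X) ∩ F_{(v_1,…,v_m)} is (d − m + 1)-connected, and that there is a sequence (y_0) of length one in F with O(X) ∩ F ⊆ F_{(y_0)}. Then F is (d+1)-connected. -/

import Mathlib

open CategoryTheory MulOpposite

/-- `O(V)`: the poset of ordered sequences of distinct elements of `V`, of length at least
one, ordered by refinement (i.e. by the sublist relation). -/
def OSeq (V : Type u) : Type u := {l : List V // l ≠ [] ∧ l.Nodup}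

instance (V : Type u) : PartialOrder (OSeq V) where
  le a b := a.1.Sublist b.1
  le_refl a := List.Sublist.refl a.1
  le_trans a b c hab hbc := List.Sublist.trans hab hbc
  le_antisymm a b h h' := Subtype.ext (List.Sublist.antisymm h h')

/-- A space is `d`-connected (for an integer `d`) if it is nonempty and all its homotopy
groups in degrees `≤ d` vanish; for `d ≤ -2` the condition is vacuous. -/
def TopDConnected (X : Type*) [TopologicalSpace X] (d : ℤ) : Prop :=
  d ≤ -2 ∨
    (Nonempty X ∧ ∀ (n : ℕ), (n : ℤ) ≤ d → ∀ x : X, Subsingleton (HomotopyGroup (Fin n) X x))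

/-- A poset is `d`-connected if the geometric realization of its order complex (nerve) is. -/
def PosetDConnected (P : Type) [PartialOrder P] (d : ℤ) : Prop :=
  TopDConnected (SSet.toTop.obj (nerve P)) d

/-- A set of sequences is `d`-connected if it is so as a subposet of `O(V)`. -/
def SetDConnected {V : Type} (F : Set (OSeq V)) (d : ℤ) : Prop :=
  PosetDConnected F d

/-- `F ⊆ O(V)` satisfies the chain condition: it is downwards closed for refinement. -/
def ChainCondition {V : Type u} (F : Set (OSeq V)) : Prop :=
  ∀ ⦃w v : OSeq V⦄, w ≤ v → v ∈ F → w ∈ F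

/-- `F_v`: the subposet of sequences `w ∈ F` whose concatenation with `v` again lies in `F`. -/
def SeqExt {V : Type u} (F : Set (OSeq V)) (v : OSeq V) : Set (OSeq V) :=
  {w | w ∈ F ∧ ∃ h : w.1 ++ v.1 ≠ [] ∧ (w.1 ++ v.1).Nodup, (⟨w.1 ++ v.1, h⟩ : OSeq V) ∈ F}

/-- `O(X)` inside `O(V)`: sequences all of whose entries lie in `X`. -/
def SeqIn {V : Type u} (X : Set V) : Set (OSeq V) :=
  {w | ∀ x ∈ w.1, x ∈ X}

/-- A sequence `v` in a right `R`-module `M` (viewed as a left `Rᵐᵒᵖ`-module) is unimodular. -/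
def IsUnimodularSeq (R : Type*) [Ring R] (M : Type*) [AddCommGroup M] [Module Rᵐᵒᵖ M]
    {n : ℕ} (v : Fin n → M) : Prop :=
  ∃ (f : Fin n → (R →ₗ[Rᵐᵒᵖ] M)) (φ : Fin n → (M →ₗ[Rᵐᵒᵖ] R)),
    (∀ i, f i 1 = v i) ∧ ∀ i j, (φ j).comp (f i) = if i = j then LinearMap.id else 0

/-- `M^∞ := M ⊕ R^∞`, where `R^∞` is free with basis `e_1, e_2, …`. -/
abbrev MInf (R : Type u) [Ring R] (M : Type u) [AddCommGroup M] [Module Rᵐᵒᵖ M] : Type u :=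
  M × (ℕ →₀ R)

/-- `U(W)`: the subposet of `O(W)` consisting of unimodular sequences in the module `W`. -/
def UnimodSeqs (R : Type*) [Ring R] (W : Type*) [AddCommGroup W] [Module Rᵐᵒᵖ W] :
    Set (OSeq W) :=
  {w | IsUnimodularSeq R W (fun i : Fin w.1.length => w.1.get i)}

/-- `R` satisfies the stable range condition `(S_s)`. -/
def SatisfiesStableRange (R : Type*) [Ring R] (s : ℕ) : Prop :=
  ∀ r : Fin (s + 1) → R,
    IsUnimodularSeq R (Fin (s + 1) → R) (fun _ : Fin 1 => r) →
      ∃ t : Fin s → R,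
        IsUnimodularSeq R (Fin s → R)
          (fun _ : Fin 1 => fun i => r i.castSucc + t i * r (Fin.last s))

namespace NerveRealization
open Simplicial Opposite

variable {P : Type} [PartialOrder P]

/-- The geometric realization of the order complex of a poset. -/
abbrev Realization (P : Type) [PartialOrder P] : Type := SSet.toTop.obj (nerve P)

/-- The singular simplex of the realization attached to a monotone sequence. -/
noncomputable def cell {n : ℕ} (c : Fin (n + 1) →o P) :
    C(stdSimplex ℝ (Fin (n + 1)), Realization P) :=
  TopCat.toSSetObjEquiv (SSet.toTop.obj (nerve P)) (op ⦋n⦌)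
    ((sSetTopAdj.unit.app (nerve P)).app (op ⦋n⦌) c.monotone.functor)

lemma cell_comp {m n : ℕ} (c : Fin (n + 1) →o P) (f : Fin (m + 1) →o Fin (n + 1))
    (t : stdSimplex ℝ (Fin (m + 1))) :
    cell (c.comp f) t = cell c (stdSimplex.map f t) := by
  have h := ConcreteCategory.congr_hom ((sSetTopAdj.unit.app (nerve P)).naturality
    (SimplexCategory.mkHom f).op) c.monotone.functor
  have h2 := congrArg (fun z => TopCat.toSSetObjEquiv (SSet.toTop.obj (nerve P)) (op ⦋m⦌) z t) h
  exact h2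

lemma exists_desc (Y : TopCat.{0})
    (φ : ∀ {n : ℕ}, (Fin (n + 1) →o P) → C(stdSimplex ℝ (Fin (n + 1)), Y))
    (hφ : ∀ {m n : ℕ} (c : Fin (n + 1) →o P) (f : Fin (m + 1) →o Fin (n + 1))
      (t : stdSimplex ℝ (Fin (m + 1))), φ (c.comp f) t = φ c (stdSimplex.map f t)) :
    ∃ g : C(Realization P, Y), ∀ {n : ℕ} (c : Fin (n + 1) →o P) t, g (cell c t) = φ c t := by
  let η : nerve P ⟶ TopCat.toSSet.obj Y :=
    { app := fun Δ => ↾fun (x : ComposableArrows P Δ.unop.len) =>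
        (TopCat.toSSetObjEquiv Y Δ).symm (φ x.toOrderHom)
      naturality := by
        intro Δ Δ' f
        ext x
        apply (TopCat.toSSetObjEquiv Y _).injective
        ext t
        exact hφ (Functor.toOrderHom x) f.unop.toOrderHom t }
  refine ⟨((sSetTopAdj.homEquiv _ _).symm η).hom, fun {n} c t => ?_⟩
  have h₀ := (sSetTopAdj.homEquiv _ _).apply_symm_apply η
  rw [Adjunction.homEquiv_unit] at h₀
  have h := ConcreteCategory.congr_hom (congrArg (fun z : nerve P ⟶ TopCat.toSSet.obj Y =>
    z.app (op ⦋n⦌)) h₀) c.monotone.functor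
  exact congrArg (fun z => TopCat.toSSetObjEquiv Y (op ⦋n⦌) z t) h

lemma hom_ext {Y : TopCat.{0}} {f g : C(Realization P, Y)}
    (h : ∀ {n : ℕ} (c : Fin (n + 1) →o P) t, f (cell c t) = g (cell c t)) : f = g := by
  have : (TopCat.ofHom f : SSet.toTop.obj (nerve P) ⟶ Y) = TopCat.ofHom g := by
    apply (sSetTopAdj.homEquiv _ _).injective
    rw [Adjunction.homEquiv_unit, Adjunction.homEquiv_unit]
    ext Δ x
    apply (TopCat.toSSetObjEquiv Y _).injective
    ext t
    exact h (Functor.toOrderHom x) t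
  exact congrArg TopCat.Hom.hom this

lemma exists_cell (x : Realization P) :
    ∃ (n : ℕ) (c : Fin (n + 1) →o P) (t : stdSimplex ℝ (Fin (n + 1))), cell c t = x := by
  let f : C(Realization P, TopCat.trivial.obj Prop) :=
    ⟨fun x => ∃ (n : ℕ) (c : Fin (n + 1) →o P) (t : stdSimplex ℝ (Fin (n + 1))), cell c t = x,
      continuous_top⟩
  let g : C(Realization P, TopCat.trivial.obj Prop) := ⟨fun _ => True, continuous_top⟩
  have h : f = g := hom_ext (Y := TopCat.trivial.obj Prop) fun {n} c t =>
    eq_true (⟨n, c, t, rfl⟩ : ∃ (m : ℕ) (c' : Fin (m + 1) →o P) (t' : stdSimplex ℝ (Fin (m + 1))),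
      cell c' t' = cell c t)
  exact of_eq_true (congrArg (fun k : C(Realization P, TopCat.trivial.obj Prop) => k x) h)

lemma isOpen_of_cells {U : Set (Realization P)}
    (hU : ∀ {n : ℕ} (c : Fin (n + 1) →o P), IsOpen (cell c ⁻¹' U)) : IsOpen U := by
  let Y : TopCat.{0} := @TopCat.of (Realization P)
    (⨆ (n : ℕ) (c : Fin (n + 1) →o P), TopologicalSpace.coinduced (cell c) inferInstance)
  have hle : Y.str ≤ (SSet.toTop.obj (nerve P)).str :=
    iSup_le fun n => iSup_le fun c => continuous_iff_coinduced_le.1 (cell c).continuous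
  obtain ⟨g, hg⟩ := exists_desc (P := P) Y
    (fun {n} c => ⟨fun t => cell c t, continuous_iff_coinduced_le.2
      (le_iSup_of_le n (le_iSup_of_le c le_rfl))⟩)
    (fun c f t => cell_comp c f t)
  let i : C(Y, Realization P) := ⟨fun x => x, continuous_id_iff_le.2 hle⟩
  have hid : i.comp g = ContinuousMap.id _ :=
    hom_ext (Y := SSet.toTop.obj (nerve P)) fun c t => hg c t
  have hgx : ∀ x, g x = x := fun x =>
    congrArg (fun k : C(Realization P, Realization P) => k x) hid
  have hUτ : @IsOpen _ Y.str U := by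
    simp only [Y, isOpen_iSup_iff, isOpen_coinduced]
    exact fun n c => hU c
  have := g.continuous.isOpen_preimage U hUτ
  convert this using 1
  ext x
  exact iff_of_eq (congrArg (· ∈ U) (hgx x).symm)

lemma isClosed_of_cells {U : Set (Realization P)}
    (hU : ∀ {n : ℕ} (c : Fin (n + 1) →o P), IsClosed (cell c ⁻¹' U)) : IsClosed U :=
  ⟨isOpen_of_cells fun c => (hU c).isOpen_compl⟩

open Classical in
lemma exists_weight (p : P) : ∃ g : C(Realization P, ℝ), ∀ {n : ℕ} (c : Fin (n + 1) →o P)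
    (t : stdSimplex ℝ (Fin (n + 1))), g (cell c t) = ∑ i, if c i = p then t i else 0 := by
  refine exists_desc (TopCat.of ℝ) (fun {n} c => ⟨fun t => ∑ i, if c i = p then t i else 0, ?_⟩) ?_
  · refine continuous_finsetSum _ fun i _ => ?_
    split_ifs
    · exact (continuous_apply i).comp continuous_subtype_val
    · exact continuous_const
  · intro m n c f t
    simp only [ContinuousMap.coe_mk, OrderHom.comp_coe, Function.comp_apply, stdSimplex.map_coe,
      FunOnFinite.linearMap_apply_apply]
    rw [← Finset.sum_fiberwise Finset.univ f]
    refine Finset.sum_congr rfl fun j _ => ?_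
    split_ifs with h
    · exact Finset.sum_congr rfl fun i hi => by simp_all
    · exact Finset.sum_eq_zero fun i hi => by simp_all

/-- The barycentric coordinate of a point of the realization at an element of the poset. -/
noncomputable def weight (p : P) : C(Realization P, ℝ) := (exists_weight p).choose

open Classical in
lemma weight_cell (p : P) {n : ℕ} (c : Fin (n + 1) →o P) (t : stdSimplex ℝ (Fin (n + 1))) :
    weight p (cell c t) = ∑ i, if c i = p then t i else 0 :=
  (exists_weight p).choose_spec c t

lemma weight_cell_of_injective {n : ℕ} {c : Fin (n + 1) →o P} (hc : Function.Injective c)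
    (t : stdSimplex ℝ (Fin (n + 1))) (i : Fin (n + 1)) : weight (c i) (cell c t) = t i := by
  classical
  rw [weight_cell]
  simp [hc.eq_iff]

lemma weight_cell_of_notMem {n : ℕ} {c : Fin (n + 1) →o P} (t : stdSimplex ℝ (Fin (n + 1))) {p : P}
    (hp : p ∉ Set.range c) : weight p (cell c t) = 0 := by
  classical
  rw [weight_cell]
  exact Finset.sum_eq_zero fun i _ => if_neg fun h => hp ⟨i, h⟩

lemma exists_strictMono_cell (x : Realization P) :
    ∃ (n : ℕ) (c : Fin (n + 1) →o P) (t : stdSimplex ℝ (Fin (n + 1))),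
      StrictMono c ∧ (∀ i, 0 < t i) ∧ cell c t = x := by
  suffices H : ∀ (n : ℕ) (c : Fin (n + 1) →o P) (t : stdSimplex ℝ (Fin (n + 1))),
      ∃ (m : ℕ) (c' : Fin (m + 1) →o P) (t' : stdSimplex ℝ (Fin (m + 1))),
        StrictMono c' ∧ (∀ i, 0 < t' i) ∧ cell c' t' = cell c t by
    obtain ⟨n, c, t, rfl⟩ := exists_cell x
    exact H n c t
  intro n
  induction n with
  | zero =>
    intro c t
    refine ⟨0, c, t, fun i j h => absurd h (by lia), fun i => ?_, rfl⟩
    have := t.2.2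
    rw [Fin.sum_univ_one] at this
    obtain rfl : i = 0 := by lia
    exact zero_lt_one.trans_eq this.symm
  | succ n ih =>
    intro c t
    by_cases h0 : ∃ i, t i = 0
    · obtain ⟨i, hi⟩ := h0
      have hs := t.2.2
      rw [Fin.sum_univ_succAbove _ i] at hs
      have hi' : t.1 i = 0 := hi
      let t' : stdSimplex ℝ (Fin (n + 1)) :=
        ⟨fun j => t (i.succAbove j), fun j => t.2.1 _, by rw [hi', zero_add] at hs; exact hs⟩
      have ht : stdSimplex.map (Fin.succAboveOrderEmb i).toOrderHom t' = t := by
        classical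
        ext j
        simp only [stdSimplex.map_coe, FunOnFinite.linearMap_apply_apply]
        rcases eq_or_ne j i with rfl | hj
        · rw [hi]
          exact Finset.sum_eq_zero fun k hk => by simp at hk
        · obtain ⟨k, rfl⟩ := Fin.exists_succAbove_eq hj
          simp [Finset.filter_eq']
          rfl
      obtain ⟨m, c', t'', h1, h2, h3⟩ := ih (c.comp (Fin.succAboveOrderEmb i).toOrderHom) t'
      exact ⟨m, c', t'', h1, h2, by rw [h3, cell_comp, ht]⟩
    · push Not at h0
      by_cases hc : StrictMono c
      · exact ⟨n + 1, c, t, hc, fun i => lt_of_le_of_ne (t.2.1 i) (h0 i).symm, rfl⟩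
      · rw [Fin.strictMono_iff_lt_succ] at hc
        push Not at hc
        obtain ⟨i, hi⟩ := hc
        have hi' : c i.castSucc = c i.succ := by
          have h := c.monotone (Fin.castSucc_lt_succ (i := i)).le
          exact (eq_or_lt_of_le h).resolve_right hi
        have hfac : (c.comp (Fin.succAboveOrderEmb i.castSucc).toOrderHom).comp
            (Fin.predAboveOrderHom i) = c := by
          ext j
          rcases eq_or_ne j i.castSucc with rfl | hj
          · simp [hi']
          · simp [Fin.succAbove_predAbove hj]
        obtain ⟨m, c', t'', h1, h2, h3⟩ := ih
          (c.comp (Fin.succAboveOrderEmb i.castSucc).toOrderHom)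
          (stdSimplex.map (Fin.predAboveOrderHom i) t)
        refine ⟨m, c', t'', h1, h2, ?_⟩
        rw [h3, ← cell_comp, hfac]

lemma weight_injective {x y : Realization P} (h : ∀ p, weight p x = weight p y) : x = y := by
  obtain ⟨n, c, t, hc, ht, rfl⟩ := exists_strictMono_cell x
  obtain ⟨m, c', t', hc', ht', rfl⟩ := exists_strictMono_cell y
  have hsupp : ∀ {n : ℕ} (c : Fin (n + 1) →o P) (t : stdSimplex ℝ (Fin (n + 1))), StrictMono c →
      (∀ i, 0 < t i) → Set.range c = {p | weight p (cell c t) ≠ 0} := by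
    intro n c t hc ht
    ext p
    refine ⟨?_, fun hp => by_contra fun hn => hp (weight_cell_of_notMem t hn)⟩
    rintro ⟨i, rfl⟩
    simpa [weight_cell_of_injective hc.injective] using (ht i).ne'
  have hr : Set.range c = Set.range c' := by rw [hsupp c t hc ht, hsupp c' t' hc' ht']; simp [h]
  have hcard : n = m := by
    have := congrArg Set.ncard hr
    rw [← Set.image_univ, ← Set.image_univ, Set.ncard_image_of_injective _ hc.injective,
      Set.ncard_image_of_injective _ hc'.injective] at this
    simpa using this
  subst hcard
  obtain rfl : c = c' := OrderHom.ext _ _ ((StrictMono.range_inj hc hc').1 hr)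
  congr 1
  ext i
  have := h (c i)
  rwa [weight_cell_of_injective hc.injective, weight_cell_of_injective hc.injective] at this
end NerveRealization

/-- A convex combination of the elements of a finite set whose support is a chain. -/
structure IsBarycentric {T : Type*} [PartialOrder T] (Q : Finset T) (x : T → ℝ) : Prop where
  nonneg : ∀ p, 0 ≤ x p
  eq_zero : ∀ p ∉ Q, x p = 0
  sum_eq_one : ∑ p ∈ Q, x p = 1
  isChain : IsChain (· ≤ ·) {p | x p ≠ 0}

/-- A family of barycentric points of the order complex of `A`, continuous over `Z` and supported
on a fixed finite set of elements. -/
def RealOn {T E : Type*} [PartialOrder T] [TopologicalSpace E] (A : Set T) (Z : Set E)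
    (f : E → T → ℝ) : Prop :=
  ∃ Q : Finset T, ↑Q ⊆ A ∧ (∀ p, ContinuousOn (fun z => f z p) Z) ∧ ∀ z ∈ Z, IsBarycentric Q (f z)

namespace NerveRealization

variable {P : Type} [PartialOrder P]

lemma exists_isBarycentric_weight (x : Realization P) :
    ∃ Q : Finset P, IsBarycentric Q (fun p => weight p x) ∧ ∀ p ∈ Q, weight p x ≠ 0 := by
  classical
  obtain ⟨n, c, t, hc, ht, rfl⟩ := exists_strictMono_cell x
  have hz : ∀ p, p ∉ Finset.univ.image c → weight p (cell c t) = 0 := fun p hp =>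
    weight_cell_of_notMem t fun ⟨i, hi⟩ => hp (Finset.mem_image.2 ⟨i, Finset.mem_univ _, hi⟩)
  refine ⟨Finset.univ.image c, ⟨fun p => ?_, hz, ?_, ?_⟩, ?_⟩
  · rw [weight_cell]
    exact Finset.sum_nonneg fun i _ => by split_ifs; exacts [t.2.1 i, le_rfl]
  · rw [Finset.sum_image hc.injective.injOn]
    simp only [weight_cell_of_injective hc.injective]
    exact t.2.2
  · refine IsChain.mono (t := Set.range c) (fun p hp => ?_) c.monotone.isChain_range
    by_contra h
    exact hp (weight_cell_of_notMem t h)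
  · intro p hp
    obtain ⟨i, -, rfl⟩ := Finset.mem_image.1 hp
    rw [weight_cell_of_injective hc.injective]
    exact (ht i).ne'

/-- A finite chain is the range of a strictly monotone sequence. -/
lemma exists_strictMono_range_eq {T : Type*} [PartialOrder T] {S : Finset T} (hS : S.Nonempty)
    (hc : IsChain (· ≤ ·) (S : Set T)) :
    ∃ (n : ℕ) (c : Fin (n + 1) →o T), StrictMono c ∧ Set.range c = S := by
  classical
  obtain ⟨n, hn⟩ : ∃ n, S.card = n + 1 := ⟨S.card - 1, by have := hS.card_pos; lia⟩
  let S' : Finset (LinearExtension T) := S.map ⟨toLinearExtension, fun _ _ h => h⟩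
  have hn' : S'.card = n + 1 := by simpa [S'] using hn
  let e := S'.orderEmbOfFin hn'
  let e' : Fin (n + 1) → T := fun i => e i
  have hmem : ∀ i, e' i ∈ S := fun i => by
    obtain ⟨p, hp, hpe⟩ := Finset.mem_map.1 (S'.orderEmbOfFin_mem hn' i)
    exact (show e' i = p from hpe.symm) ▸ hp
  have hmono : StrictMono e' := fun i j hij => by
    have hlt : e i < e j := e.strictMono hij
    have hne : e' i ≠ e' j := fun h => hlt.ne h
    refine lt_of_le_of_ne ((hc (hmem i) (hmem j) hne).resolve_right fun h => ?_) hne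
    exact absurd (toLinearExtension.monotone h) (not_le.2 hlt)
  refine ⟨n, ⟨e', hmono.monotone⟩, hmono, ?_⟩
  have hr : Set.range e = S' := S'.range_orderEmbOfFin hn'
  ext p
  refine ⟨fun ⟨i, hi⟩ => hi ▸ hmem i, fun hp => ?_⟩
  have : (toLinearExtension p) ∈ Set.range e := by
    rw [hr]
    exact Finset.mem_coe.2 (Finset.mem_map.2 ⟨p, hp, rfl⟩)
  exact this

lemma exists_weight_eq {Q : Finset P} {x : P → ℝ} (hx : IsBarycentric Q x) :
    ∃ z : Realization P, ∀ p, weight p z = x p := by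
  classical
  have hsum : ∑ p ∈ Q.filter (x · ≠ 0), x p = 1 := by
    rw [Finset.sum_filter_ne_zero, hx.sum_eq_one]
  obtain ⟨n, c, hc, hr⟩ := exists_strictMono_range_eq (S := Q.filter (x · ≠ 0))
    (Finset.nonempty_of_sum_ne_zero (hsum.trans_ne one_ne_zero))
    (hx.isChain.mono fun p hp => (Finset.mem_filter.1 (Finset.mem_coe.1 hp)).2)
  have himg : Finset.univ.image c = Q.filter (x · ≠ 0) := by
    rw [← Finset.coe_inj, Finset.coe_image, Finset.coe_univ, Set.image_univ, hr]
  refine ⟨cell c ⟨fun i => x (c i), fun i => hx.nonneg _, ?_⟩, fun p => ?_⟩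
  · rw [← hsum, ← himg, Finset.sum_image hc.injective.injOn]
  · by_cases hp : p ∈ Set.range c
    · obtain ⟨i, rfl⟩ := hp
      exact weight_cell_of_injective hc.injective _ i
    · rw [weight_cell_of_notMem _ hp]
      rw [hr] at hp
      by_cases hQ : p ∈ Q
      · by_contra h
        exact hp (by simpa [hQ] using Ne.symm h)
      · exact (hx.eq_zero p hQ).symm

lemma continuous_of_realOn {K : Type*} [TopologicalSpace K] {A : Set P} {f : K → Realization P}
    (hf : RealOn A Set.univ fun k p => weight p (f k)) : Continuous f := by
  classical
  obtain ⟨Q, -, hcont, hpt⟩ := hf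
  let Z : Finset P → Set K := fun S => {k | S.Nonempty ∧ IsChain (· ≤ ·) (S : Set P) ∧
    ∀ p, p ∉ S → weight p (f k) = 0}
  have hcover : ⋃ S : Q.powerset, Z S = Set.univ := by
    refine Set.eq_univ_of_forall fun k => Set.mem_iUnion.2 ?_
    have hk := hpt k trivial
    refine ⟨⟨Q.filter (weight · (f k) ≠ 0), by simp⟩, ?_, ?_, ?_⟩
    · refine Finset.nonempty_of_sum_ne_zero (f := fun p => weight p (f k)) ?_
      rw [Finset.sum_filter_ne_zero, hk.sum_eq_one]
      exact one_ne_zero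
    · exact hk.isChain.mono fun p hp => (Finset.mem_filter.1 (Finset.mem_coe.1 hp)).2
    · intro p hp
      by_cases hQ : p ∈ Q
      · by_contra h
        exact hp (by simpa [hQ] using h)
      · exact hk.eq_zero p hQ
  refine (locallyFinite_of_finite _).continuous hcover (fun S => ?_) fun S => ?_
  · have : Z S = {k | (S : Finset P).Nonempty ∧ IsChain (· ≤ ·) (((S : Finset P)) : Set P)} ∩
        ⋂ p, ⋂ (_ : p ∉ (S : Finset P)), {k | weight p (f k) = 0} := by
      ext k; simp [Z, and_assoc]
    rw [this]
    refine isClosed_const.inter (isClosed_iInter fun p => isClosed_iInter fun _ => ?_)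
    exact isClosed_eq (continuousOn_univ.1 (hcont p)) continuous_const
  · rcases (Z S).eq_empty_or_nonempty with h | ⟨k₀, hne, hch, -⟩
    · rw [h]
      exact continuousOn_empty _
    obtain ⟨n, c, hc, hr⟩ := exists_strictMono_range_eq hne hch
    have hmem : ∀ k : Z S, (fun i => weight (c i) (f k)) ∈ stdSimplex ℝ (Fin (n + 1)) := by
      rintro ⟨k, -, -, hk⟩
      refine ⟨fun i => (hpt k trivial).nonneg _, ?_⟩
      rw [← Finset.sum_image (f := fun p => weight p (f k)) (s := Finset.univ) hc.injective.injOn]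
      rw [← (hpt k trivial).sum_eq_one]
      have himg : Finset.univ.image c = (S : Finset P) := by
        rw [← Finset.coe_inj, Finset.coe_image, Finset.coe_univ, Set.image_univ, hr]
      rw [himg]
      exact Finset.sum_subset (Finset.mem_powerset.1 S.2) fun p _ hp => hk p hp
    rw [continuousOn_iff_continuous_domRestrict]
    have heq : (Z S).domRestrict f = fun k => cell c ⟨_, hmem k⟩ := by
      ext k
      refine weight_injective fun p => ?_
      by_cases hp : p ∈ Set.range c
      · obtain ⟨i, rfl⟩ := hp
        rw [weight_cell_of_injective hc.injective]
        rfl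
      · rw [weight_cell_of_notMem _ hp]
        rw [hr] at hp
        exact k.2.2.2 p hp
    rw [heq]
    refine (cell c).continuous.comp (Continuous.subtype_mk (continuous_pi fun i => ?_) _)
    exact (continuousOn_univ.1 (hcont (c i))).comp continuous_subtype_val

end NerveRealization

section RealOn

open Set Metric

variable {T T' E E' : Type*} [PartialOrder T] [PartialOrder T'] {A B : Set T}

lemma IsBarycentric.mono {Q Q' : Finset T} {x : T → ℝ} (h : IsBarycentric Q x) (hQ : Q ⊆ Q') :
    IsBarycentric Q' x where
  nonneg := h.nonneg
  eq_zero p hp := h.eq_zero p fun hp' => hp (hQ hp')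
  sum_eq_one := by
    rw [← h.sum_eq_one]
    exact (Finset.sum_subset hQ fun p _ hp => h.eq_zero p hp).symm
  isChain := h.isChain

lemma IsBarycentric.mem_of_ne_zero {Q : Finset T} {x : T → ℝ} (h : IsBarycentric Q x) {p : T}
    (hp : x p ≠ 0) : p ∈ Q := by_contra fun hn => hp (h.eq_zero p hn)

/-- Restricting the finite support set of a barycentric point to a set containing its support. -/
lemma IsBarycentric.of_support {Q Q' : Finset T} {x : T → ℝ} (h : IsBarycentric Q x)
    (hQ : ∀ p, x p ≠ 0 → p ∈ Q') : IsBarycentric Q' x := by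
  classical
  have hz : ∀ p, p ∉ Q' → x p = 0 := fun p hp => by_contra fun hn => hp (hQ p hn)
  refine ⟨h.nonneg, hz, ?_, h.isChain⟩
  rw [← (h.mono (Finset.subset_union_left (s₂ := Q'))).sum_eq_one]
  exact Finset.sum_subset Finset.subset_union_right fun p _ hp => hz p hp

open Classical in
lemma isBarycentric_single (p : T) : IsBarycentric {p} (Pi.single p (1 : ℝ)) where
  nonneg q := by by_cases h : q = p <;> simp [h]
  eq_zero q hq := by simp_all
  sum_eq_one := by simp
  isChain := (Set.subsingleton_singleton (a := p)).isChain.mono fun q hq => by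
    by_contra h
    exact hq (Pi.single_eq_of_ne h _)

namespace RealOn

variable [TopologicalSpace E] [TopologicalSpace E'] {Z Z' : Set E} {f g : E → T → ℝ}

lemma mono_left (h : RealOn A Z f) (hAB : A ⊆ B) : RealOn B Z f :=
  let ⟨Q, hQ, hf⟩ := h
  ⟨Q, hQ.trans hAB, hf⟩

lemma mono_right (h : RealOn A Z f) (hZ : Z' ⊆ Z) : RealOn A Z' f :=
  let ⟨Q, hQ, hf, hb⟩ := h
  ⟨Q, hQ, fun p => (hf p).mono hZ, fun z hz => hb z (hZ hz)⟩

lemma congr (h : RealOn A Z f) (hfg : ∀ z ∈ Z, g z = f z) : RealOn A Z g :=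
  let ⟨Q, hQ, hf, hb⟩ := h
  ⟨Q, hQ, fun p => (hf p).congr fun z hz => congrFun (hfg z hz) p,
    fun z hz => (hfg z hz).symm ▸ hb z hz⟩

lemma comp {W : Set E'} {φ : E' → E} (h : RealOn A Z f) (hφ : ContinuousOn φ W)
    (hm : MapsTo φ W Z) : RealOn A W fun w => f (φ w) :=
  let ⟨Q, hQ, hf, hb⟩ := h
  ⟨Q, hQ, fun p => (hf p).comp hφ hm, fun _ hw => hb _ (hm hw)⟩

lemma union (h : RealOn A Z f) (h' : RealOn A Z' f) (hZ : IsClosed Z) (hZ' : IsClosed Z') :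
    RealOn A (Z ∪ Z') f := by
  classical
  obtain ⟨Q, hQ, hf, hb⟩ := h
  obtain ⟨Q', hQ', hf', hb'⟩ := h'
  refine ⟨Q ∪ Q', by simp [hQ, hQ'], fun p => (hf p).union_of_isClosed (hf' p) hZ hZ', ?_⟩
  rintro z (hz | hz)
  · exact (hb z hz).mono Finset.subset_union_left
  · exact (hb' z hz).mono Finset.subset_union_right

lemma mem_of_ne_zero (h : RealOn A Z f) {z : E} (hz : z ∈ Z) {p : T} (hp : f z p ≠ 0) : p ∈ A :=
  let ⟨_, hQ, _, hb⟩ := h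
  hQ ((hb z hz).mem_of_ne_zero hp)

lemma of_support (h : RealOn A Z f) (hB : ∀ z ∈ Z, ∀ p, f z p ≠ 0 → p ∈ B) : RealOn B Z f := by
  classical
  obtain ⟨Q, hQ, hf, hb⟩ := h
  refine ⟨Q.filter (· ∈ B), fun p hp => (Finset.mem_filter.1 hp).2, hf, fun z hz =>
    (hb z hz).of_support fun p hp => ?_⟩
  exact Finset.mem_filter.2 ⟨(hb z hz).mem_of_ne_zero hp, hB z hz p hp⟩

open Classical in
lemma single {p : T} (hp : p ∈ A) (Z : Set E) : RealOn A Z fun _ => Pi.single p (1 : ℝ) :=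
  ⟨{p}, by simpa using hp, fun _ => continuousOn_const, fun _ _ => isBarycentric_single p⟩

end RealOn

/-- A homotopy between two families of barycentric points over `S`. -/
def RealHtpy [TopologicalSpace E] (A : Set T) (S : Set E) (g g' : E → T → ℝ) : Prop :=
  ∃ H : E × ℝ → T → ℝ, RealOn A (S ×ˢ Icc 0 1) H ∧ (∀ z ∈ S, H (z, 0) = g z) ∧
    ∀ z ∈ S, H (z, 1) = g' z

/-- A family of barycentric points over the unit sphere extends over the unit ball. -/
def ExtendsToBall [NormedAddCommGroup E] (A : Set T) (g : E → T → ℝ) : Prop :=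
  ∃ G : E → T → ℝ, RealOn A (closedBall 0 1) G ∧ EqOn G g (sphere 0 1)

/-- The order complex of `A` has the extension property for the pair `(Dᵏ, Sᵏ⁻¹)`. -/
def ExtProp (A : Set T) (k : ℕ) : Prop :=
  ∀ g : (Fin k → ℝ) → T → ℝ, RealOn A (sphere 0 1) g → ExtendsToBall A g

lemma RealHtpy.of_isChain [TopologicalSpace E] {S : Set E} {g g' : E → T → ℝ} (hg : RealOn A S g)
    (hg' : RealOn A S g')
    (hc : ∀ z ∈ S, IsChain (· ≤ ·) ({p | g z p ≠ 0} ∪ {p | g' z p ≠ 0})) : RealHtpy A S g g' := by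
  classical
  obtain ⟨Q, hQ, hf, hb⟩ := hg
  obtain ⟨Q', hQ', hf', hb'⟩ := hg'
  refine ⟨fun w p => (1 - w.2) * g w.1 p + w.2 * g' w.1 p, ⟨Q ∪ Q', by simp [hQ, hQ'], ?_, ?_⟩,
    fun z _ => by ext p; simp, fun z _ => by ext p; simp⟩
  · intro p
    have hm : MapsTo Prod.fst (S ×ˢ Icc (0 : ℝ) 1) S := fun w hw => hw.1
    exact ((continuousOn_const.sub continuousOn_snd).mul ((hf p).comp continuousOn_fst hm)).add
      (continuousOn_snd.mul ((hf' p).comp continuousOn_fst hm))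
  · rintro ⟨z, s⟩ ⟨hz, hs0, hs1⟩
    have h1 := (hb z hz).mono (Finset.subset_union_left (s₂ := Q'))
    have h2 := (hb' z hz).mono (Finset.subset_union_right (s₁ := Q))
    refine ⟨fun p => ?_, fun p hp => ?_, ?_, ?_⟩
    · exact add_nonneg (mul_nonneg (sub_nonneg.2 hs1) (h1.nonneg p)) (mul_nonneg hs0 (h2.nonneg p))
    · simp [h1.eq_zero p hp, h2.eq_zero p hp]
    · simp only [Finset.sum_add_distrib, ← Finset.mul_sum, h1.sum_eq_one, h2.sum_eq_one]
      ring
    · refine (hc z hz).mono fun p hp => ?_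
      by_contra hn
      simp only [mem_union, mem_ofPred_eq, not_or, not_not] at hn
      exact hp (by simp [hn.1, hn.2])

/-- Collar argument: extendability over the ball is invariant under homotopy. -/
lemma RealHtpy.extendsToBall [NormedAddCommGroup E] [NormedSpace ℝ E] {g g' : E → T → ℝ}
    (h : RealHtpy A (sphere 0 1) g g') (hg' : ExtendsToBall A g') : ExtendsToBall A g := by
  classical
  obtain ⟨H, hH, h0, h1⟩ := h
  obtain ⟨G, hG, hGg⟩ := hg'
  let inner : E → T → ℝ := fun y => G ((2 : ℝ) • y)
  let outer : E → T → ℝ := fun y => H (‖y‖⁻¹ • y, 2 - 2 * ‖y‖)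
  let Zi : Set E := closedBall 0 (1 / 2)
  let Zo : Set E := {y | 1 / 2 ≤ ‖y‖} ∩ closedBall 0 1
  have hin : RealOn A Zi inner := by
    refine hG.comp (by fun_prop) fun y hy => ?_
    simp only [Zi, mem_closedBall, dist_zero_right, norm_smul] at hy ⊢
    norm_num
    linarith
  have hout : RealOn A Zo outer := by
    have hne : ∀ y ∈ Zo, ‖y‖ ≠ 0 := fun y hy => by
      have : (1 : ℝ) / 2 ≤ ‖y‖ := hy.1
      positivity
    refine hH.comp (ContinuousOn.prodMk ((continuousOn_id.norm.inv₀ hne).smul continuousOn_id)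
      (by fun_prop)) fun y hy => ?_
    have hy1 : (1 : ℝ) / 2 ≤ ‖y‖ := hy.1
    have hy2 : ‖y‖ ≤ 1 := by simpa using hy.2
    refine ⟨?_, ?_, ?_⟩
    · simp [norm_smul, hne y hy]
    · simp only; linarith
    · simp only; linarith
  have hagree : ∀ y : E, ‖y‖ = 1 / 2 → inner y = outer y := by
    intro y hy
    have hs : (2 : ℝ) • y ∈ sphere (0 : E) 1 := by simp [norm_smul, hy]
    simp only [inner, outer, hy]
    norm_num
    rw [h1 _ hs, hGg hs]
  let Φ : E → T → ℝ := fun y => if ‖y‖ ≤ 1 / 2 then inner y else outer y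
  have hΦi : ∀ y ∈ Zi, Φ y = inner y := fun y hy => if_pos (by simpa [Zi] using hy)
  have hΦo : ∀ y ∈ Zo, Φ y = outer y := fun y hy => by
    by_cases hle : ‖y‖ ≤ 1 / 2
    · rw [← hagree y (le_antisymm hle hy.1)]
      exact if_pos hle
    · exact if_neg hle
  refine ⟨Φ, ((hin.congr hΦi).union (hout.congr hΦo) isClosed_closedBall
    ((isClosed_le continuous_const continuous_norm).inter isClosed_closedBall)).mono_right
    fun y hy => ?_, fun y hy => ?_⟩
  · rcases le_total ‖y‖ (1 / 2) with h | h
    · exact Or.inl (by simpa [Zi] using h)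
    · exact Or.inr ⟨h, hy⟩
  · have hy1 : ‖y‖ = 1 := by simpa using hy
    rw [hΦo y ⟨by simp only [mem_ofPred_eq, hy1]; norm_num, by simp [hy1]⟩]
    simp only [outer, hy1]
    norm_num
    exact h0 y hy

open Classical in
lemma extendsToBall_single [NormedAddCommGroup E] {p : T} (hp : p ∈ A) :
    ExtendsToBall A (fun _ : E => Pi.single p (1 : ℝ)) :=
  ⟨_, RealOn.single hp _, fun _ _ => rfl⟩

end RealOn

section Prism

open Set Metric

variable {T T' E : Type*}

open Classical in
/-- The pushforward of a finitely supported weight function. -/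
noncomputable def pushWeight (Q : Finset T) (h : T → T') (x : T → ℝ) : T' → ℝ :=
  fun w => ∑ p ∈ Q, if h p = w then x p else 0

lemma pushWeight_id {Q : Finset T} {x : T → ℝ} (hx : ∀ p ∉ Q, x p = 0) :
    pushWeight Q (fun p => p) x = x := by
  classical
  ext w
  simp only [pushWeight, Finset.sum_ite_eq']
  exact ite_eq_left_iff.2 fun h => (hx w h).symm

lemma exists_of_pushWeight_ne_zero {Q : Finset T} {h : T → T'} {x : T → ℝ} {w : T'}
    (hw : pushWeight Q h x w ≠ 0) : ∃ p ∈ Q, x p ≠ 0 ∧ h p = w := by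
  classical
  obtain ⟨p, hp, hne⟩ := Finset.exists_ne_zero_of_sum_ne_zero hw
  have : h p = w := by_contra fun hn => hne (if_neg hn)
  exact ⟨p, hp, by simpa [this] using hne, this⟩

variable [PartialOrder T] [PartialOrder T'] {A : Set T} {B : Set T'}

open Classical in
/-- The part of the weight at `p` that has moved up at time `s`, when the mass of `x` is moved
starting from the top. -/
noncomputable def movedWeight (Q : Finset T) (x : T → ℝ) (s : ℝ) (p : T) : ℝ :=
  min (x p) (max 0 (s - ∑ q ∈ Q with p < q, x q))

open Classical in
lemma movedWeight_le_of_lt {Q : Finset T} {x : T → ℝ} (hx : IsBarycentric Q x) {p p' : T}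
    (hp : p ∈ Q) (hlt : p' < p) :
    x p + ∑ q ∈ Q with p < q, x q ≤ ∑ q ∈ Q with p' < q, x q := by
  rw [← Finset.sum_insert (s := Q.filter (p < ·)) (f := x) (a := p) (by simp)]
  refine Finset.sum_le_sum_of_subset_of_nonneg (fun q hq => ?_) fun q _ _ => hx.nonneg q
  rcases Finset.mem_insert.1 hq with rfl | hq
  · exact Finset.mem_filter.2 ⟨hp, hlt⟩
  · have := Finset.mem_filter.1 hq
    exact Finset.mem_filter.2 ⟨this.1, hlt.trans this.2⟩

open Classical in
/-- Comparable monotone maps induce homotopic maps of order complexes. -/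
lemma RealHtpy.pushWeight [TopologicalSpace E] {Z : Set E} {x : E → T → ℝ} {Q : Finset T}
    (hQ : ↑Q ⊆ A) (hcont : ∀ p, ContinuousOn (fun z => x z p) Z)
    (hx : ∀ z ∈ Z, IsBarycentric Q (x z)) {h₀ h₁ : T → T'} (hm₀ : MonotoneOn h₀ A)
    (hm₁ : MonotoneOn h₁ A) (hle : ∀ p ∈ A, h₀ p ≤ h₁ p) (hB₀ : MapsTo h₀ A B)
    (hB₁ : MapsTo h₁ A B) :
    RealHtpy B Z (fun z => pushWeight Q h₀ (x z)) (fun z => pushWeight Q h₁ (x z)) := by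
  have hm_nonneg : ∀ z ∈ Z, ∀ s p, 0 ≤ movedWeight Q (x z) s p := fun z hz s p =>
    le_min ((hx z hz).nonneg p) (le_max_left _ _)
  have hm_le : ∀ z s p, movedWeight Q (x z) s p ≤ x z p := fun z s p => min_le_left _ _
  refine ⟨fun w v => ∑ p ∈ Q, ((if h₀ p = v then x w.1 p - movedWeight Q (x w.1) w.2 p else 0) +
      if h₁ p = v then movedWeight Q (x w.1) w.2 p else 0), ⟨Q.image h₀ ∪ Q.image h₁, ?_, ?_, ?_⟩,
      fun z hz => ?_, fun z hz => ?_⟩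
  · intro v hv
    rcases Finset.mem_union.1 (Finset.mem_coe.1 hv) with hv | hv <;>
    · obtain ⟨p, hp, rfl⟩ := Finset.mem_image.1 hv
      first | exact hB₀ (hQ hp) | exact hB₁ (hQ hp)
  · intro v
    have hxc : ∀ p, ContinuousOn (fun w : E × ℝ => x w.1 p) (Z ×ˢ Icc (0 : ℝ) 1) := fun p =>
      (hcont p).comp continuousOn_fst fun _ hw => hw.1
    have hmc : ∀ p, ContinuousOn (fun w : E × ℝ => movedWeight Q (x w.1) w.2 p)
        (Z ×ˢ Icc (0 : ℝ) 1) := fun p =>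
      (hxc p).inf (continuousOn_const.sup (continuousOn_snd.sub
        (continuousOn_finsetSum _ fun q _ => hxc q)))
    refine continuousOn_finsetSum _ fun p _ => ContinuousOn.add ?_ ?_
    · split_ifs
      exacts [(hxc p).sub (hmc p), continuousOn_const]
    · split_ifs
      exacts [hmc p, continuousOn_const]
  · rintro ⟨z, s⟩ ⟨hz, hs⟩
    have hsupp : ∀ v, (∑ p ∈ Q, ((if h₀ p = v then x z p - movedWeight Q (x z) s p else 0) +
        if h₁ p = v then movedWeight Q (x z) s p else 0)) ≠ 0 → ∃ p ∈ Q,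
        (h₀ p = v ∧ movedWeight Q (x z) s p < x z p) ∨ (h₁ p = v ∧ 0 < movedWeight Q (x z) s p) := by
      intro v hv
      obtain ⟨p, hp, hne⟩ := Finset.exists_ne_zero_of_sum_ne_zero hv
      refine ⟨p, hp, by_contra fun hn => hne ?_⟩
      rw [not_or, not_and, not_and, not_lt, not_lt] at hn
      have e1 : (if h₀ p = v then x z p - movedWeight Q (x z) s p else 0) = 0 :=
        ite_eq_right_iff.2 fun h => sub_eq_zero.2 (le_antisymm (hn.1 h) (hm_le z s p))
      have e2 : (if h₁ p = v then movedWeight Q (x z) s p else 0) = 0 :=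
        ite_eq_right_iff.2 fun h => le_antisymm (hn.2 h) (hm_nonneg z hz s p)
      rw [e1, e2, add_zero]
    refine ⟨fun v => ?_, fun v hv => ?_, ?_, ?_⟩
    · refine Finset.sum_nonneg fun p _ => add_nonneg ?_ ?_
      · split_ifs
        exacts [sub_nonneg.2 (hm_le z s p), le_rfl]
      · split_ifs
        exacts [hm_nonneg z hz s p, le_rfl]
    · by_contra hne
      obtain ⟨p, hp, ⟨rfl, -⟩ | ⟨rfl, -⟩⟩ := hsupp v hne
      · exact hv (Finset.mem_union_left _ (Finset.mem_image_of_mem _ hp))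
      · exact hv (Finset.mem_union_right _ (Finset.mem_image_of_mem _ hp))
    · simp only
      rw [Finset.sum_comm, ← (hx z hz).sum_eq_one]
      refine Finset.sum_congr rfl fun p hp => ?_
      rw [Finset.sum_add_distrib, Finset.sum_ite_eq, Finset.sum_ite_eq,
        if_pos (Finset.mem_union_left _ (Finset.mem_image_of_mem _ hp)),
        if_pos (Finset.mem_union_right _ (Finset.mem_image_of_mem _ hp)), sub_add_cancel]
    · have hne_of_lt : ∀ p, movedWeight Q (x z) s p < x z p → x z p ≠ 0 := fun p h =>
        ((hm_nonneg z hz s p).trans_lt h).ne'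
      have hne_of_pos : ∀ p, 0 < movedWeight Q (x z) s p → x z p ≠ 0 := fun p h =>
        (h.trans_le (hm_le z s p)).ne'
      have hcmp : ∀ p ∈ Q, ∀ p' ∈ Q, x z p ≠ 0 → x z p' ≠ 0 → p ≤ p' ∨ p' ≤ p :=
        fun p _ p' _ h h' => (hx z hz).isChain.total h h'
      have hcross : ∀ p ∈ Q, ∀ p' ∈ Q, movedWeight Q (x z) s p < x z p →
          0 < movedWeight Q (x z) s p' → h₀ p ≤ h₁ p' := by
        intro p hp p' hp' hlt hpos
        have hpp : p ≤ p' := by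
          by_contra hn
          have hlt' : p' < p := lt_of_le_of_ne
            ((hcmp p hp p' hp' (hne_of_lt p hlt) (hne_of_pos p' hpos)).resolve_left hn)
            fun h => hn h.ge
          have h1 := movedWeight_le_of_lt (hx z hz) hp hlt'
          have h2 : s - ∑ q ∈ Q with p < q, x z q < x z p := by
            rcases min_lt_iff.1 hlt with h | h
            · exact absurd h (lt_irrefl _)
            · exact (le_max_right _ _).trans_lt h
          have h3 : 0 < s - ∑ q ∈ Q with p' < q, x z q := by
            have := (lt_min_iff.1 hpos).2
            exact (lt_max_iff.1 this).resolve_left (lt_irrefl _)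
          linarith
        exact (hm₀ (hQ hp) (hQ hp') hpp).trans (hle p' (hQ hp'))
      intro v hv v' hv' _
      obtain ⟨p, hp, hpv⟩ := hsupp v hv
      obtain ⟨p', hp', hpv'⟩ := hsupp v' hv'
      rcases hpv with ⟨rfl, h⟩ | ⟨rfl, h⟩ <;> rcases hpv' with ⟨rfl, h'⟩ | ⟨rfl, h'⟩
      · exact (hcmp p hp p' hp' (hne_of_lt p h) (hne_of_lt p' h')).imp
          (hm₀ (hQ hp) (hQ hp')) (hm₀ (hQ hp') (hQ hp))
      · exact Or.inl (hcross p hp p' hp' h h')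
      · exact Or.inr (hcross p' hp' p hp h' h)
      · exact (hcmp p hp p' hp' (hne_of_pos p h) (hne_of_pos p' h')).imp
          (hm₁ (hQ hp) (hQ hp')) (hm₁ (hQ hp') (hQ hp))
  · have hzero : ∀ p, movedWeight Q (x z) 0 p = 0 := fun p => by
      have : (0 : ℝ) - ∑ q ∈ Q with p < q, x z q ≤ 0 := by
        simpa using Finset.sum_nonneg fun q _ => (hx z hz).nonneg q
      rw [movedWeight, max_eq_left this, min_eq_right ((hx z hz).nonneg p)]
    ext v
    simp [hzero, _root_.pushWeight]
  · have hone : ∀ p ∈ Q, movedWeight Q (x z) 1 p = x z p := fun p hp => by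
      refine min_eq_left (le_max_of_le_right ?_)
      have h1 := (hx z hz).sum_eq_one
      have h2 : x z p + ∑ q ∈ Q with p < q, x z q ≤ ∑ q ∈ Q, x z q := by
        rw [← Finset.sum_insert (s := Q.filter (p < ·)) (f := x z) (a := p) (by simp)]
        refine Finset.sum_le_sum_of_subset_of_nonneg (fun q hq => ?_) fun q _ _ =>
          (hx z hz).nonneg q
        rcases Finset.mem_insert.1 hq with rfl | hq
        exacts [hp, (Finset.mem_filter.1 hq).1]
      linarith
    ext v
    exact Finset.sum_congr rfl fun p hp => by simp [hone p hp]

lemma RealHtpy.left [TopologicalSpace E] {Z : Set E} {g g' : E → T → ℝ} (h : RealHtpy A Z g g') :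
    RealOn A Z g :=
  let ⟨_, hH, h0, _⟩ := h
  (hH.comp (φ := fun z => (z, (0 : ℝ))) (by fun_prop) fun _ hz => ⟨hz, by simp⟩).congr
    fun z hz => (h0 z hz).symm

lemma RealHtpy.symm [TopologicalSpace E] {Z : Set E} {g g' : E → T → ℝ} (h : RealHtpy A Z g g') :
    RealHtpy A Z g' g := by
  obtain ⟨H, hH, h0, h1⟩ := h
  refine ⟨fun w => H (w.1, 1 - w.2), hH.comp (φ := fun w : E × ℝ => (w.1, 1 - w.2))
    (by fun_prop) fun w hw => ⟨hw.1, ?_, ?_⟩, fun z hz => ?_, fun z hz => ?_⟩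
  · linarith [hw.2.2]
  · linarith [hw.2.1]
  · simp [h1 z hz]
  · simp [h0 z hz]

lemma RealOn.pushWeight [TopologicalSpace E] {Z : Set E} {x : E → T → ℝ} {Q : Finset T}
    (hQ : ↑Q ⊆ A) (hcont : ∀ p, ContinuousOn (fun z => x z p) Z)
    (hx : ∀ z ∈ Z, IsBarycentric Q (x z)) {h : T → T'} (hm : MonotoneOn h A) (hB : MapsTo h A B) :
    RealOn B Z (fun z => pushWeight Q h (x z)) :=
  (RealHtpy.pushWeight hQ hcont hx hm hm (fun _ _ => le_rfl) hB hB).left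

/-- If the inclusion of `A` in `B` is dominated by a monotone map into the upper set of a point,
then it is nullhomotopic. -/
lemma extendsToBall_of_conical {A B : Set T} (hAB : A ⊆ B) {h : T → T} (hm : MonotoneOn h A)
    (hA : MapsTo h A B) {z₀ : T} (hz₀ : z₀ ∈ B) (hle : ∀ z ∈ A, z ≤ h z) (hge : ∀ z ∈ A, z₀ ≤ h z)
    [NormedAddCommGroup E] [NormedSpace ℝ E] {g : E → T → ℝ} (hg : RealOn A (sphere 0 1) g) :
    ExtendsToBall B g := by
  classical
  obtain ⟨Q, hQ, hcont, hg⟩ := hg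
  have H := RealHtpy.pushWeight hQ hcont hg (B := B) (h₀ := fun p => p) (h₁ := h)
    (fun _ _ _ _ h => h) hm hle hAB hA
  have hid : ∀ z ∈ sphere (0 : E) 1, g z = pushWeight Q (fun p => p) (g z) := fun z hz =>
    (pushWeight_id (hg z hz).eq_zero).symm
  have hpush : RealOn B (sphere (0 : E) 1) fun z => pushWeight Q h (g z) :=
    RealOn.pushWeight hQ hcont hg hm hA
  have H' : RealHtpy B (sphere (0 : E) 1) (fun z => pushWeight Q h (g z))
      fun _ => Pi.single z₀ 1 := by
    refine RealHtpy.of_isChain hpush (RealOn.single hz₀ _) fun z hz => ?_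
    have hsub : {p | (Pi.single z₀ (1 : ℝ) : T → ℝ) p ≠ 0} ⊆ {z₀} := fun p hp => by
      by_contra hn
      exact hp (Pi.single_eq_of_ne hn _)
    obtain ⟨Q', -, -, hb⟩ := hpush
    intro p hp q hq hpq
    have hge' : ∀ p, pushWeight Q h (g z) p ≠ 0 → z₀ ≤ p := fun p hp => by
      obtain ⟨p', hp', -, rfl⟩ := exists_of_pushWeight_ne_zero hp
      exact hge p' (hQ hp')
    rcases hp with hp | hp <;> rcases hq with hq | hq
    · exact (hb z hz).isChain hp hq hpq
    · exact Or.inr ((hsub hq) ▸ hge' p hp)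
    · exact Or.inl ((hsub hp) ▸ hge' q hq)
    · exact absurd ((hsub hp).trans (hsub hq).symm) hpq
  obtain ⟨G, hG, hGg⟩ := H.extendsToBall (H'.extendsToBall (extendsToBall_single hz₀))
  exact ⟨G, hG, fun z hz => (hGg hz).trans (hid z hz).symm⟩

/-- A poset that retracts monotonically onto the upper set of a point is contractible. -/
lemma extProp_of_conical {h : T → T} (hm : MonotoneOn h A) (hA : MapsTo h A A) {z₀ : T}
    (hz₀ : z₀ ∈ A) (hle : ∀ z ∈ A, z ≤ h z) (hge : ∀ z ∈ A, z₀ ≤ h z) (k : ℕ) : ExtProp A k :=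
  fun _ hg => extendsToBall_of_conical subset_rfl hm hA hz₀ hle hge hg

end Prism

section Carrier

open Set Metric Topology

variable {T I E : Type*} [PartialOrder T] {A : Set T}

/-- The face spanned by `c` of the full simplex with vertex set `I`. -/
def simplexFace (c : Finset I) : Set (I → ℝ) :=
  {x | (∀ p, 0 ≤ x p) ∧ (∀ p ∉ c, x p = 0) ∧ ∑ p ∈ c, x p = 1}

/-- The boundary of a face of the full simplex. -/
def simplexFaceBoundary (c : Finset I) : Set (I → ℝ) :=
  {x | x ∈ simplexFace c ∧ ∃ p ∈ c, x p = 0}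

lemma isClosed_simplexFace (c : Finset I) : IsClosed (simplexFace c) := by
  have : simplexFace c = (⋂ p, {x : I → ℝ | 0 ≤ x p}) ∩
      ((⋂ p, ⋂ (_ : p ∉ c), {x : I → ℝ | x p = 0}) ∩ {x | ∑ p ∈ c, x p = 1}) := by
    ext x; simp [simplexFace]
  rw [this]
  refine (isClosed_iInter fun p => isClosed_le continuous_const (continuous_apply p)).inter
    ((isClosed_iInter fun p => isClosed_iInter fun _ =>
      isClosed_eq (continuous_apply p) continuous_const).inter
      (isClosed_eq (by fun_prop) continuous_const))

lemma simplexFaceBoundary_eq [DecidableEq I] (c : Finset I) :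
    simplexFaceBoundary c = ⋃ p ∈ c, simplexFace (c.erase p) := by
  ext x
  simp only [mem_iUnion]
  constructor
  · rintro ⟨⟨h0, h1, h2⟩, p, hp, hx⟩
    refine ⟨p, hp, h0, fun q hq => ?_, ?_⟩
    · by_cases hqp : q = p
      · rw [hqp, hx]
      · exact h1 q fun hq' => hq (Finset.mem_erase.2 ⟨hqp, hq'⟩)
    · rw [← Finset.add_sum_erase c x hp, hx, zero_add] at h2
      exact h2
  · rintro ⟨p, hp, h0, h1, h2⟩
    have hx : x p = 0 := h1 p (Finset.notMem_erase p c)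
    refine ⟨⟨h0, fun q hq => h1 q fun hq' => hq (Finset.mem_of_mem_erase hq'), ?_⟩, p, hp, hx⟩
    rw [← Finset.add_sum_erase c x hp, hx, zero_add, h2]

lemma RealOn.biUnion_finset [TopologicalSpace E] {ι : Type*} (s : Finset ι) {Z : ι → Set E}
    {f : E → T → ℝ} (hZ : ∀ i ∈ s, IsClosed (Z i)) (h : ∀ i ∈ s, RealOn A (Z i) f) :
    RealOn A (⋃ i ∈ s, Z i) f := by
  classical
  induction s using Finset.induction_on with
  | empty => exact ⟨∅, by simp, by simp, by simp⟩
  | insert a s _ ih =>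
    rw [Finset.set_biUnion_insert]
    refine (h a (Finset.mem_insert_self a s)).union
      (ih (fun i hi => hZ i (Finset.mem_insert_of_mem hi))
        fun i hi => h i (Finset.mem_insert_of_mem hi)) (hZ a (Finset.mem_insert_self a s)) ?_
    exact s.finite_toSet.isClosed_biUnion fun i hi => hZ i (Finset.mem_insert_of_mem hi)

/-- The corner simplex in `ℝᵏ`. -/
def cornerSimplex (k : ℕ) : Set (Fin k → ℝ) := {u | (∀ i, 0 ≤ u i) ∧ ∑ i, u i ≤ 1}

lemma isClosed_cornerSimplex (k : ℕ) : IsClosed (cornerSimplex k) := by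
  have : cornerSimplex k = (⋂ i, {u : Fin k → ℝ | 0 ≤ u i}) ∩ {u | ∑ i, u i ≤ 1} := by
    ext x; simp [cornerSimplex]
  rw [this]
  exact (isClosed_iInter fun p => isClosed_le continuous_const (continuous_apply p)).inter
      (isClosed_le (by fun_prop) continuous_const)

lemma subset_interior_cornerSimplex (k : ℕ) :
    {u | (∀ i, 0 < u i) ∧ ∑ i, u i < 1} ⊆ interior (cornerSimplex k) := by
  have : {u : Fin k → ℝ | (∀ i, 0 < u i) ∧ ∑ i, u i < 1} =
      (⋂ i, {u : Fin k → ℝ | 0 < u i}) ∩ {u | ∑ i, u i < 1} := by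
    ext x; simp
  refine interior_maximal (fun u hu => ⟨fun i => (hu.1 i).le, hu.2.le⟩) ?_
  rw [this]
  exact (isOpen_iInter_of_finite fun p => isOpen_lt continuous_const (continuous_apply p)).inter
      (isOpen_lt (by fun_prop) continuous_const)

lemma exists_add_smul_mem_of_mem_interior {V : Type*} [AddCommGroup V] [Module ℝ V]
    [TopologicalSpace V] [ContinuousAdd V] [ContinuousSMul ℝ V] {K : Set V} {u : V}
    (hu : u ∈ interior K) (w : V) : ∃ s : ℝ, 0 < s ∧ u + s • w ∈ K := by
  have hc : Filter.Tendsto (fun s : ℝ => u + s • w) (𝓝[>] 0) (𝓝 u) := by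
    have : Continuous fun s : ℝ => u + s • w := by fun_prop
    simpa using (this.tendsto 0).mono_left nhdsWithin_le_nhds
  obtain ⟨s, h1, h2⟩ := ((hc.eventually_mem (mem_interior_iff_mem_nhds.1 hu)).and
    self_mem_nhdsWithin).exists
  exact ⟨s, h2, h1⟩

lemma interior_cornerSimplex_subset (k : ℕ) :
    interior (cornerSimplex k) ⊆ {u | (∀ i, 0 < u i) ∧ ∑ i, u i < 1} := by
  intro u hu
  have hK := interior_subset hu
  refine ⟨fun i => lt_of_le_of_ne (hK.1 i) fun h => ?_, lt_of_le_of_ne hK.2 fun h => ?_⟩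
  · obtain ⟨s, hs, hm⟩ := exists_add_smul_mem_of_mem_interior hu (Pi.single i (-1))
    have := hm.1 i
    simp [← h] at this
    linarith
  · obtain ⟨s, hs, hm⟩ := exists_add_smul_mem_of_mem_interior hu u
    have := hm.2
    simp only [Pi.add_apply, Pi.smul_apply, smul_eq_mul, Finset.sum_add_distrib,
      ← Finset.mul_sum, h] at this
    linarith

lemma mem_frontier_cornerSimplex {k : ℕ} {u : Fin k → ℝ} (hu : u ∈ cornerSimplex k) :
    u ∈ frontier (cornerSimplex k) ↔ (∃ i, u i = 0) ∨ ∑ i, u i = 1 := by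
  rw [(isClosed_cornerSimplex k).frontier_eq, mem_sdiff,
    Subset.antisymm (interior_cornerSimplex_subset k) (subset_interior_cornerSimplex k)]
  simp only [hu, true_and, mem_ofPred_eq, not_and_or, not_forall, not_lt]
  refine or_congr (exists_congr fun i => ⟨fun h => le_antisymm h (hu.1 i), fun h => h.le⟩)
    ⟨fun h => le_antisymm hu.2 h, fun h => h.ge⟩

lemma exists_homeomorph_cornerSimplex (k : ℕ) : ∃ h : (Fin k → ℝ) ≃ₜ (Fin k → ℝ),
    h '' cornerSimplex k = closedBall 0 1 ∧ h '' frontier (cornerSimplex k) = sphere 0 1 := by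
  have hconv : Convex ℝ (cornerSimplex k) := by
    rintro u ⟨hu, hu'⟩ v ⟨hv, hv'⟩ a b ha hb hab
    refine ⟨fun i => add_nonneg (mul_nonneg ha (hu i)) (mul_nonneg hb (hv i)), ?_⟩
    simp only [Pi.add_apply, Pi.smul_apply, smul_eq_mul, Finset.sum_add_distrib, ← Finset.mul_sum]
    nlinarith
  have hne : (interior (cornerSimplex k)).Nonempty := by
    refine ⟨fun _ => 1 / (k + 1), subset_interior_cornerSimplex k ⟨fun _ => by positivity, ?_⟩⟩
    simp only [Finset.sum_const, Finset.card_univ, Fintype.card_fin, nsmul_eq_mul]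
    rw [mul_one_div, div_lt_one (by positivity)]
    linarith
  have hb : Bornology.IsBounded (cornerSimplex k) := by
    refine (isBounded_closedBall (x := (0 : Fin k → ℝ)) (r := 1)).subset fun u hu => ?_
    rw [mem_closedBall, dist_zero_right, pi_norm_le_iff_of_nonneg zero_le_one]
    intro i
    rw [Real.norm_of_nonneg (hu.1 i)]
    exact (Finset.single_le_sum (fun j _ => hu.1 j) (Finset.mem_univ i)).trans hu.2
  obtain ⟨h, -, h2, h3⟩ :=
    exists_homeomorph_image_interior_closure_frontier_eq_unitBall hconv hne hb
  exact ⟨h, by rwa [(isClosed_cornerSimplex k).closure_eq] at h2, h3⟩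

/-- The extension property for balls gives the extension property for simplices. -/
lemma ExtProp.exists_extend_simplexFace {c : Finset I} {k : ℕ} (hc : c.card = k + 1)
    (hA : ExtProp A k) {g : (I → ℝ) → T → ℝ} (hg : RealOn A (simplexFaceBoundary c) g) :
    ∃ G, RealOn A (simplexFace c) G ∧ EqOn G g (simplexFaceBoundary c) := by
  classical
  let e : Fin (k + 1) ≃ c := (Fintype.equivFinOfCardEq (by simpa using hc)).symm
  let α : (Fin k → ℝ) → I → ℝ := fun u p =>
    if hp : p ∈ c then (Fin.cons (1 - ∑ i, u i) u : Fin (k + 1) → ℝ) (e.symm ⟨p, hp⟩) else 0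
  let β : (I → ℝ) → Fin k → ℝ := fun x i => x (e i.succ)
  have hα0 : ∀ u, α u (e 0) = 1 - ∑ i, u i := fun u => by simp [α]
  have hαs : ∀ u i, α u (e (Fin.succ i)) = u i := fun u i => by simp [α]
  have hcases : ∀ p ∈ c, p = e 0 ∨ ∃ i : Fin k, p = e i.succ := fun p hp => by
    obtain ⟨j, hj⟩ := e.surjective ⟨p, hp⟩
    cases j using Fin.cases with
    | zero => exact Or.inl (by rw [hj])
    | succ i => exact Or.inr ⟨i, by rw [hj]⟩
  have hsum : ∀ x : I → ℝ, ∑ p ∈ c, x p = x (e 0) + ∑ i, β x i := fun x => by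
    rw [← Finset.sum_coe_sort, ← e.sum_comp, Fin.sum_univ_succ]
  have hαc : Continuous α := by
    refine continuous_pi fun p => ?_
    by_cases hp : p ∈ c
    · rcases hcases p hp with rfl | ⟨i, rfl⟩
      · simp only [hα0]; fun_prop
      · simp only [hαs]; fun_prop
    · simp only [α, hp, dite_false]; fun_prop
  have hβc : Continuous β := continuous_pi fun i => continuous_apply _
  have hαβ : ∀ x ∈ simplexFace c, α (β x) = x := by
    rintro x ⟨-, h1, h2⟩
    ext p
    by_cases hp : p ∈ c
    · rcases hcases p hp with rfl | ⟨i, rfl⟩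
      · rw [hα0]
        linarith [hsum x]
      · rw [hαs]
    · simp [α, hp, h1 p hp]
  have hαm : ∀ u ∈ cornerSimplex k, α u ∈ simplexFace c := by
    rintro u ⟨h1, h2⟩
    refine ⟨fun p => ?_, fun p hp => by simp [α, hp], ?_⟩
    · by_cases hp : p ∈ c
      · rcases hcases p hp with rfl | ⟨i, rfl⟩
        · rw [hα0]; linarith
        · rw [hαs]; exact h1 i
      · simp [α, hp]
    · rw [hsum, hα0]
      simp [β, hαs]
  have hβm : ∀ x ∈ simplexFace c, β x ∈ cornerSimplex k := by
    rintro x ⟨h0, -, h2⟩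
    exact ⟨fun i => h0 _, by linarith [hsum x, h0 (e 0)]⟩
  have hαfr : ∀ u ∈ frontier (cornerSimplex k), α u ∈ simplexFaceBoundary c := by
    intro u hu
    have hu' := (isClosed_cornerSimplex k).frontier_subset hu
    refine ⟨hαm u hu', ?_⟩
    rcases (mem_frontier_cornerSimplex hu').1 hu with ⟨i, hi⟩ | h
    · exact ⟨e i.succ, (e i.succ).2, by rw [hαs, hi]⟩
    · exact ⟨e 0, (e 0).2, by rw [hα0, h, sub_self]⟩
  have hβfr : ∀ x ∈ simplexFaceBoundary c, β x ∈ frontier (cornerSimplex k) := by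
    rintro x ⟨hx, p, hp, hxp⟩
    rw [mem_frontier_cornerSimplex (hβm x hx)]
    rcases hcases p hp with rfl | ⟨i, rfl⟩
    · exact Or.inr (by have := hx.2.2; rw [hsum, hxp, zero_add] at this; exact this)
    · exact Or.inl ⟨i, hxp⟩
  obtain ⟨h, hK, hfr⟩ := exists_homeomorph_cornerSimplex k
  have hsymm : ∀ y ∈ sphere (0 : Fin k → ℝ) 1, h.symm y ∈ frontier (cornerSimplex k) := by
    intro y hy
    rw [← hfr] at hy
    obtain ⟨u, hu, rfl⟩ := hy
    simpa using hu
  obtain ⟨G, hG, hGg⟩ := hA (fun y => g (α (h.symm y)))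
    (hg.comp (hαc.comp h.symm.continuous).continuousOn fun y hy => hαfr _ (hsymm y hy))
  refine ⟨fun x => G (h (β x)), hG.comp (h.continuous.comp hβc).continuousOn fun x hx => ?_,
    fun x hx => ?_⟩
  · rw [← hK]
    exact mem_image_of_mem h (hβm x hx)
  · have : h (β x) ∈ sphere (0 : Fin k → ℝ) 1 := hfr ▸ mem_image_of_mem h (hβfr x hx)
    simp only [hGg this, Homeomorph.symm_apply_apply, hαβ x hx.1]

/-- Acyclic carriers: a monotone family of sufficiently connected posets indexed by the faces of a
finite simplicial complex carries a map. -/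
lemma exists_carried [Fintype I] {𝒦 : Set (Finset I)} (hdown : ∀ c ∈ 𝒦, ∀ c' ⊆ c, c' ∈ 𝒦)
    {C : Finset I → Set T} (hC : Monotone C)
    (hext : ∀ c ∈ 𝒦, ∀ k, c.card = k + 1 → ExtProp (C c) k) :
    ∃ Ψ : (I → ℝ) → T → ℝ, ∀ c ∈ 𝒦, RealOn (C c) (simplexFace c) Ψ := by
  classical
  suffices H : ∀ n, ∃ Ψ : (I → ℝ) → T → ℝ, ∀ c ∈ 𝒦, c.card ≤ n →
      RealOn (C c) (simplexFace c) Ψ by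
    obtain ⟨Ψ, hΨ⟩ := H (Fintype.card I)
    exact ⟨Ψ, fun c hc => hΨ c hc (Finset.card_le_univ c)⟩
  intro n
  induction n with
  | zero =>
    refine ⟨fun _ _ => 0, fun c _ hcard => ?_⟩
    obtain rfl : c = ∅ := by simpa using hcard
    have : simplexFace (∅ : Finset I) = ∅ := by ext x; simp [simplexFace]
    rw [this]
    exact ⟨∅, by simp, by simp, by simp⟩
  | succ n ih =>
    obtain ⟨Ψ, hΨ⟩ := ih
    have hG : ∀ c : Finset I, ∃ G : (I → ℝ) → T → ℝ, c ∈ 𝒦 → c.card = n + 1 →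
        RealOn (C c) (simplexFace c) G ∧ EqOn G Ψ (simplexFaceBoundary c) := by
      intro c
      by_cases hc : c ∈ 𝒦 ∧ c.card = n + 1
      · have hb : RealOn (C c) (simplexFaceBoundary c) Ψ := by
          rw [simplexFaceBoundary_eq]
          refine RealOn.biUnion_finset c (fun p _ => isClosed_simplexFace _) fun p hp => ?_
          refine (hΨ _ (hdown c hc.1 _ (Finset.erase_subset p c)) ?_).mono_left
            (hC (Finset.erase_subset p c))
          rw [Finset.card_erase_of_mem hp, hc.2, Nat.add_sub_cancel]
        obtain ⟨G, hG⟩ := (hext c hc.1 n hc.2).exists_extend_simplexFace hc.2 hb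
        exact ⟨G, fun _ _ => hG⟩
      · exact ⟨Ψ, fun h1 h2 => absurd ⟨h1, h2⟩ hc⟩
    choose G hG using hG
    let supp : (I → ℝ) → Finset I := fun x => Finset.univ.filter (x · ≠ 0)
    have hsupp : ∀ {c x}, x ∈ simplexFace c → supp x ⊆ c := fun {c x} hx p hp =>
      by_contra fun hn => (Finset.mem_filter.1 hp).2 (hx.2.1 p hn)
    refine ⟨fun x => if (supp x).card = n + 1 then G (supp x) x else Ψ x, fun c hc hcard => ?_⟩
    rcases hcard.eq_or_lt with hcard | hcard
    · refine (hG c hc hcard).1.congr fun x hx => ?_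
      by_cases hfull : supp x = c
      · simp only [hfull, hcard, if_true]
      · have hlt := Finset.card_lt_card ((hsupp hx).ssubset_of_ne hfull)
        rw [if_neg (by lia)]
        obtain ⟨p, hp, hp'⟩ := Finset.exists_of_ssubset ((hsupp hx).ssubset_of_ne hfull)
        refine ((hG c hc hcard).2 ⟨hx, p, hp, ?_⟩).symm
        simpa [supp] using hp'
    · refine (hΨ c hc (by lia)).congr fun x hx => ?_
      have := Finset.card_le_card (hsupp hx)
      rw [if_neg (by lia)]

end Carrier

section FineCover

open Set Metric Topology

variable {n : ℕ}

/-- The hat function at the lattice point `a` of the Kuhn triangulation. -/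
noncomputable def kuhnHat (a : Fin (n + 1) → ℤ) (t : Fin (n + 1) → ℝ) : ℝ :=
  max 0 (1 - ‖fun i => max 0 (t i - a i)‖ - ‖fun i => max 0 (a i - t i)‖)

lemma continuous_kuhnHat (a : Fin (n + 1) → ℤ) : Continuous (kuhnHat a) := by
  unfold kuhnHat
  fun_prop

lemma kuhnHat_nonneg (a : Fin (n + 1) → ℤ) (t : Fin (n + 1) → ℝ) : 0 ≤ kuhnHat a t :=
  le_max_left _ _

lemma exists_of_kuhnHat_pos {a : Fin (n + 1) → ℤ} {t : Fin (n + 1) → ℝ} (h : 0 < kuhnHat a t) :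
    ∃ p m : ℝ, 0 ≤ p ∧ 0 ≤ m ∧ p + m < 1 ∧ (∀ i, t i - a i ≤ p) ∧ ∀ i, a i - t i ≤ m := by
  refine ⟨‖fun i => max 0 (t i - a i)‖, ‖fun i => max 0 (a i - t i)‖, norm_nonneg _,
    norm_nonneg _, ?_, fun i => ?_, fun i => ?_⟩
  · have := (lt_max_iff.1 h).resolve_left (lt_irrefl _)
    linarith
  · have := norm_le_pi_norm (fun i => max 0 (t i - a i)) i
    rw [Real.norm_of_nonneg (le_max_left _ _)] at this
    exact (le_max_right _ _).trans this
  · have := norm_le_pi_norm (fun i => max 0 (a i - t i)) i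
    rw [Real.norm_of_nonneg (le_max_left _ _)] at this
    exact (le_max_right _ _).trans this

lemma abs_sub_lt_one_of_kuhnHat_pos {a : Fin (n + 1) → ℤ} {t : Fin (n + 1) → ℝ}
    (h : 0 < kuhnHat a t) (i : Fin (n + 1)) : |t i - a i| < 1 := by
  obtain ⟨p, m, hp, hm, hpm, h1, h2⟩ := exists_of_kuhnHat_pos h
  rw [abs_lt]
  constructor <;> linarith [h1 i, h2 i]

lemma kuhnHat_floor_pos (t : Fin (n + 1) → ℝ) : 0 < kuhnHat (fun i => ⌊t i⌋) t := by
  have hneg : (fun i => max 0 ((⌊t i⌋ : ℝ) - t i)) = (0 : Fin (n + 1) → ℝ) := by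
    ext i
    exact max_eq_left (by linarith [Int.floor_le (t i)])
  have hpos : ‖fun i => max 0 (t i - (⌊t i⌋ : ℝ))‖ < 1 := by
    rw [pi_norm_lt_iff one_pos]
    intro i
    rw [Real.norm_of_nonneg (le_max_left _ _)]
    exact max_lt one_pos (by linarith [Int.lt_floor_add_one (t i)])
  rw [kuhnHat, hneg, norm_zero]
  exact lt_max_of_lt_right (by linarith)

lemma le_or_le_of_kuhnHat_pos {a b : Fin (n + 1) → ℤ} {t : Fin (n + 1) → ℝ}
    (ha : 0 < kuhnHat a t) (hb : 0 < kuhnHat b t) : a ≤ b ∨ b ≤ a := by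
  by_contra! hn
  obtain ⟨h1, h2⟩ := hn
  simp only [Pi.le_def, not_forall, not_le] at h1 h2
  obtain ⟨i, hi⟩ := h1
  obtain ⟨j, hj⟩ := h2
  obtain ⟨p, m, hp, hm, hpm, h1, h2⟩ := exists_of_kuhnHat_pos ha
  obtain ⟨p', m', hp', hm', hpm', h1', h2'⟩ := exists_of_kuhnHat_pos hb
  have hi' : (b i : ℝ) + 1 ≤ a i := by exact_mod_cast hi
  have hj' : (a j : ℝ) + 1 ≤ b j := by exact_mod_cast hj
  linarith [h2 i, h1' i, h2' j, h1 j]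

lemma card_le_of_kuhnHat_pos {B : Finset (Fin (n + 1) → ℤ)} {t : Fin (n + 1) → ℝ}
    (hB : ∀ a ∈ B, 0 < kuhnHat a t) {i₀ : Fin (n + 1)} {z : ℤ} (hz : t i₀ = z) :
    B.card ≤ n + 1 := by
  classical
  rcases B.eq_empty_or_nonempty with rfl | hne
  · simp
  obtain ⟨b, hb, hmin⟩ := B.exists_min_image (fun a => ∑ i, a i) hne
  have hdiff : ∀ a ∈ B, ∀ i, a i ≤ b i + 1 := fun a ha i => by
    have h1 := abs_lt.1 (abs_sub_lt_one_of_kuhnHat_pos (hB a ha) i)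
    have h2 := abs_lt.1 (abs_sub_lt_one_of_kuhnHat_pos (hB b hb) i)
    have h3 : (a i : ℝ) < b i + 2 := by linarith
    have h4 : a i < b i + 2 := by exact_mod_cast h3
    lia
  have hfix : ∀ a ∈ B, a i₀ = z := fun a ha => by
    have h1 := abs_lt.1 (abs_sub_lt_one_of_kuhnHat_pos (hB a ha) i₀)
    rw [hz] at h1
    have h2 : (z : ℝ) < a i₀ + 1 := by linarith
    have h3 : (a i₀ : ℝ) < z + 1 := by linarith
    have h4 : z < a i₀ + 1 := by exact_mod_cast h2
    have h5 : a i₀ < z + 1 := by exact_mod_cast h3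
    lia
  have hinj : Set.InjOn (fun a : Fin (n + 1) → ℤ => ∑ i, a i) B := by
    intro a ha a' ha' h
    have key : ∀ {a a' : Fin (n + 1) → ℤ}, a ≤ a' → ∑ i, a i = ∑ i, a' i → a = a' :=
      fun {a a'} hle h => funext fun i =>
        (Finset.sum_eq_sum_iff_of_le (fun i _ => hle i)).1 h i (Finset.mem_univ i)
    rcases le_or_le_of_kuhnHat_pos (hB a ha) (hB a' ha') with hle | hle
    · exact key hle h
    · exact (key hle h.symm).symm
  rw [← Finset.card_image_of_injOn hinj]
  have hsub : B.image (fun a => ∑ i, a i) ⊆ Finset.Icc (∑ i, b i) (∑ i, b i + n) := by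
    intro s hs
    obtain ⟨a, ha, rfl⟩ := Finset.mem_image.1 hs
    refine Finset.mem_Icc.2 ⟨hmin a ha, ?_⟩
    rw [← Finset.add_sum_erase _ (fun i => a i) (Finset.mem_univ i₀),
      ← Finset.add_sum_erase _ (fun i => b i) (Finset.mem_univ i₀), hfix a ha, hfix b hb]
    have h1 := Finset.sum_le_sum (s := Finset.univ.erase i₀) fun i _ => hdiff a ha i
    rw [Finset.sum_add_distrib] at h1
    simp only [Finset.sum_const, Finset.card_erase_of_mem (Finset.mem_univ i₀), Finset.card_univ,
      Fintype.card_fin, Nat.add_sub_cancel, nsmul_eq_mul, mul_one] at h1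
    linarith
  refine (Finset.card_le_card hsub).trans ?_
  rw [Int.card_Icc]
  lia

/-- Open covers of the `n`-sphere admit partitions of unity (up to normalization) subordinate to
them, with at most `n + 1` functions nonvanishing at any point. -/
lemma exists_fine_cover {ι : Type*} {U : ι → Set (Fin (n + 1) → ℝ)} (hU : ∀ v, IsOpen (U v))
    (hcov : sphere 0 1 ⊆ ⋃ v, U v) :
    ∃ (W : Type) (_ : Fintype W) (ρ : W → (Fin (n + 1) → ℝ) → ℝ) (v : W → ι),
      (∀ a, Continuous (ρ a)) ∧ (∀ a y, 0 ≤ ρ a y) ∧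
      (∀ y ∈ sphere (0 : Fin (n + 1) → ℝ) 1, ∃ a, 0 < ρ a y) ∧
      (∀ a, ∀ y ∈ sphere (0 : Fin (n + 1) → ℝ) 1, 0 < ρ a y → y ∈ U (v a)) ∧
      ∀ y ∈ sphere (0 : Fin (n + 1) → ℝ) 1, ∀ s : Finset W, (∀ a ∈ s, 0 < ρ a y) →
        s.card ≤ n + 1 := by
  classical
  obtain ⟨δ, hδ, hleb⟩ := lebesgue_number_lemma_of_metric (isCompact_sphere _ _) hU hcov
  obtain ⟨N, hN⟩ := exists_nat_gt (2 / δ)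
  have hN0 : (0 : ℝ) < N := (by positivity : (0 : ℝ) < 2 / δ).trans hN
  have hNδ : 2 < N * δ := (div_lt_iff₀ hδ).1 hN
  let W : Finset (Fin (n + 1) → ℤ) := Fintype.piFinset fun _ => Finset.Icc (-N : ℤ) N
  let ρ : W → (Fin (n + 1) → ℝ) → ℝ := fun a y => kuhnHat a.1 ((N : ℝ) • y)
  have hv : ∀ a : W, ∃ v : ι, ∀ y ∈ sphere (0 : Fin (n + 1) → ℝ) 1, 0 < ρ a y → y ∈ U v := by
    intro a
    by_cases h : ∃ y₀ ∈ sphere (0 : Fin (n + 1) → ℝ) 1, 0 < ρ a y₀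
    · obtain ⟨y₀, hy₀, hpos₀⟩ := h
      obtain ⟨v, hv⟩ := hleb y₀ hy₀
      refine ⟨v, fun y hy hpos => hv ?_⟩
      rw [mem_ball, dist_pi_lt_iff hδ]
      intro i
      have h1 := abs_lt.1 (abs_sub_lt_one_of_kuhnHat_pos hpos₀ i)
      have h2 := abs_lt.1 (abs_sub_lt_one_of_kuhnHat_pos hpos i)
      simp only [Pi.smul_apply, smul_eq_mul] at h1 h2
      rw [Real.dist_eq, abs_lt]
      constructor
      · by_contra! hn
        nlinarith [mul_le_mul_of_nonneg_left hn hN0.le]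
      · by_contra! hn
        nlinarith [mul_le_mul_of_nonneg_left hn hN0.le]
    · have hne : (sphere (0 : Fin (n + 1) → ℝ) 1).Nonempty :=
        NormedSpace.sphere_nonempty.2 zero_le_one
      obtain ⟨v, -⟩ := mem_iUnion.1 (hcov hne.some_mem)
      exact ⟨v, fun y hy hpos => absurd ⟨y, hy, hpos⟩ h⟩
  choose v hv using hv
  refine ⟨W, inferInstance, ρ, v, fun a => (continuous_kuhnHat a.1).comp (by fun_prop),
    fun a y => kuhnHat_nonneg _ _, fun y hy => ?_, hv, fun y hy s hs => ?_⟩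
  · refine ⟨⟨fun i => ⌊((N : ℝ) • y) i⌋, Fintype.mem_piFinset.2 fun i => ?_⟩, kuhnHat_floor_pos _⟩
    have hi : |y i| ≤ 1 := by
      rw [← Real.norm_eq_abs]
      exact (norm_le_pi_norm y i).trans (by simpa using (mem_sphere.1 hy).le)
    have hi' := abs_le.1 hi
    simp only [Pi.smul_apply, smul_eq_mul]
    refine Finset.mem_Icc.2 ⟨Int.le_floor.2 ?_, Int.floor_le_iff.2 ?_⟩
    · push_cast
      nlinarith
    · push_cast
      nlinarith
  · obtain ⟨i₀, z, hz⟩ : ∃ (i₀ : Fin (n + 1)) (z : ℤ), ((N : ℝ) • y) i₀ = z := by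
      obtain ⟨i₀, hi₀⟩ : ∃ i, ‖y i‖ = 1 := by
        by_contra! hn
        have hy1 : ‖y‖ = 1 := by simpa using hy
        have : ‖y‖ < 1 := (pi_norm_lt_iff one_pos).2 fun i =>
          lt_of_le_of_ne ((norm_le_pi_norm y i).trans hy1.le) (hn i)
        linarith
      rcases (abs_eq zero_le_one).1 hi₀ with h | h
      · exact ⟨i₀, N, by simp [h]⟩
      · exact ⟨i₀, -N, by simp [h]⟩
    rw [← Finset.card_map (Function.Embedding.subtype _)]
    refine card_le_of_kuhnHat_pos (fun a ha => ?_) hz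
    obtain ⟨a', ha', rfl⟩ := Finset.mem_map.1 ha
    exact hs a' ha'

end FineCover

section NerveApproximation

open Set Metric Topology

variable {T I E : Type*} [PartialOrder T] {A : Set T}

/-- Composition with a carried map. -/
lemma RealOn.comp_carried [TopologicalSpace E] [Fintype I] {𝒦 : Set (Finset I)}
    {C : Finset I → Set T} {Ψ : (I → ℝ) → T → ℝ} (hΨ : ∀ c ∈ 𝒦, RealOn (C c) (simplexFace c) Ψ)
    {Z : Set E} {x : E → I → ℝ} (hx : ∀ i, ContinuousOn (fun z => x z i) Z)
    (hc : ∀ z ∈ Z, ∃ c ∈ 𝒦, C c ⊆ A ∧ x z ∈ simplexFace c) : RealOn A Z fun z => Ψ (x z) := by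
  classical
  have h : RealOn A (⋃ c ∈ Finset.univ.filter fun c => c ∈ 𝒦 ∧ C c ⊆ A, simplexFace c) Ψ :=
    RealOn.biUnion_finset _ (fun c _ => isClosed_simplexFace c) fun c hc =>
      (hΨ c (Finset.mem_filter.1 hc).2.1).mono_left (Finset.mem_filter.1 hc).2.2
  refine h.comp (continuousOn_pi.2 hx) fun z hz => ?_
  obtain ⟨c, h1, h2, h3⟩ := hc z hz
  exact mem_biUnion (show c ∈ _ from Finset.mem_filter.2 ⟨Finset.mem_univ _, h1, h2⟩) h3

lemma IsBarycentric.mem_simplexFace [PartialOrder I] {Q c : Finset I} {x : I → ℝ}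
    (hx : IsBarycentric Q x) (hc : ∀ p, x p ≠ 0 → p ∈ c) : x ∈ simplexFace c :=
  have h := hx.of_support hc
  ⟨h.nonneg, h.eq_zero, h.sum_eq_one⟩

open Classical in
/-- The unnormalized barycentric coordinate, in the barycentric subdivision, of the point with
coordinates `r`. -/
noncomputable def subdivisionWeight {W : Type*} [Fintype W] (r : W → ℝ) (σ : Finset W) : ℝ :=
  (∏ a ∈ σ, r a) * ∏ a ∈ σ, ∏ b ∈ σᶜ, max 0 (r a - r b)

lemma subdivisionWeight_pos_of_ne_zero {W : Type*} [Fintype W] {r : W → ℝ} (hr : ∀ a, 0 ≤ r a)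
    {σ : Finset W} (h : subdivisionWeight r σ ≠ 0) :
    (∀ a ∈ σ, 0 < r a) ∧ ∀ a ∈ σ, ∀ b ∉ σ, r b < r a := by
  classical
  obtain ⟨h1, h2⟩ := mul_ne_zero_iff.1 h
  refine ⟨fun a ha => lt_of_le_of_ne (hr a) (Finset.prod_ne_zero_iff.1 h1 a ha).symm,
    fun a ha b hb => ?_⟩
  have h3 := Finset.prod_ne_zero_iff.1 (Finset.prod_ne_zero_iff.1 h2 a ha) b
    (Finset.mem_compl.2 hb)
  by_contra hn
  exact h3 (max_eq_left (by linarith))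

/-- Approximation of a map from a sphere by the order complex of the face poset of the nerve of a
fine cover. -/
lemma exists_nerve_approximation {n : ℕ} {g : (Fin (n + 1) → ℝ) → T → ℝ}
    (hg : RealOn A (sphere 0 1) g) :
    ∃ (W : Type) (_ : Fintype W) (v : W → T) (x : (Fin (n + 1) → ℝ) → Finset W → ℝ),
      RealOn {σ : Finset W | σ.Nonempty ∧ σ.card ≤ n + 1 ∧ IsChain (· ≤ ·) (v '' σ) ∧
        ∀ a ∈ σ, v a ∈ A} (sphere 0 1) x ∧
      ∀ y ∈ sphere (0 : Fin (n + 1) → ℝ) 1, ∀ σ, x y σ ≠ 0 → ∀ a ∈ σ, g y (v a) ≠ 0 := by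
  classical
  obtain ⟨Q, hQ, hcont, hb⟩ := hg
  have hU : ∀ p : T, ∃ u : Set (Fin (n + 1) → ℝ), IsOpen u ∧
      (fun z => g z p) ⁻¹' {0}ᶜ ∩ sphere 0 1 = u ∩ sphere 0 1 := fun p =>
    continuousOn_iff'.1 (hcont p) _ isOpen_compl_singleton
  choose U hUo hU using hU
  have hmemU : ∀ p, ∀ y ∈ sphere (0 : Fin (n + 1) → ℝ) 1, y ∈ U p ↔ g y p ≠ 0 := by
    intro p y hy
    have := congrArg (y ∈ ·) (hU p)
    simp only [mem_inter_iff, hy, and_true] at this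
    exact this.symm.to_iff
  have hcov : sphere (0 : Fin (n + 1) → ℝ) 1 ⊆ ⋃ p, U p := by
    intro y hy
    have h1 : ∑ p ∈ Q, g y p ≠ 0 := by rw [(hb y hy).sum_eq_one]; exact one_ne_zero
    obtain ⟨p, -, hp⟩ := Finset.exists_ne_zero_of_sum_ne_zero h1
    exact mem_iUnion.2 ⟨p, (hmemU p y hy).2 hp⟩
  obtain ⟨W, _, ρ, v, hρc, hρ0, hρpos, hρU, hρcard⟩ := exists_fine_cover hUo hcov
  let ξ : (Fin (n + 1) → ℝ) → Finset W → ℝ := fun y σ =>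
    if σ.Nonempty then subdivisionWeight (fun a => ρ a y) σ else 0
  have hξ0 : ∀ y σ, 0 ≤ ξ y σ := fun y σ => by
    by_cases hσ : σ.Nonempty
    · simp only [ξ, hσ, if_true]
      exact mul_nonneg (Finset.prod_nonneg fun a _ => hρ0 a y)
        (Finset.prod_nonneg fun a _ => Finset.prod_nonneg fun b _ => le_max_left _ _)
    · simp [ξ, hσ]
  have hξne : ∀ y σ, ξ y σ ≠ 0 → σ.Nonempty ∧ (∀ a ∈ σ, 0 < ρ a y) ∧
      ∀ a ∈ σ, ∀ b ∉ σ, ρ b y < ρ a y := fun y σ h => by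
    by_cases hσ : σ.Nonempty
    · simp only [ξ, hσ, if_true] at h
      exact ⟨hσ, subdivisionWeight_pos_of_ne_zero (fun a => hρ0 a y) h⟩
    · simp [ξ, hσ] at h
  have hξc : ∀ σ, Continuous fun y => ξ y σ := fun σ => by
    by_cases hσ : σ.Nonempty
    · simp only [ξ, hσ, if_true, subdivisionWeight]
      fun_prop
    · simp only [ξ, hσ, if_false]
      fun_prop
  have hsum : ∀ y ∈ sphere (0 : Fin (n + 1) → ℝ) 1, 0 < ∑ σ, ξ y σ := by
    intro y hy
    obtain ⟨a₀, ha₀⟩ := hρpos y hy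
    obtain ⟨m, -, hm⟩ := Finset.exists_max_image Finset.univ (fun a => ρ a y)
      ⟨a₀, Finset.mem_univ _⟩
    have hmpos : 0 < ρ m y := ha₀.trans_le (hm a₀ (Finset.mem_univ _))
    let σ : Finset W := Finset.univ.filter fun a => ρ a y = ρ m y
    have hσ : σ.Nonempty := ⟨m, by simp [σ]⟩
    refine Finset.sum_pos' (fun σ _ => hξ0 y σ) ⟨σ, Finset.mem_univ _, ?_⟩
    simp only [ξ, hσ, if_true]
    refine mul_pos (Finset.prod_pos fun a ha => ?_) (Finset.prod_pos fun a ha =>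
      Finset.prod_pos fun b hb' => lt_max_of_lt_right (sub_pos.2 ?_))
    · rw [(Finset.mem_filter.1 ha).2]
      exact hmpos
    · simp only [(Finset.mem_filter.1 ha).2]
      refine lt_of_le_of_ne (hm b (Finset.mem_univ _)) fun h => ?_
      exact Finset.mem_compl.1 hb' (Finset.mem_filter.2 ⟨Finset.mem_univ _, h⟩)
  have hxne : ∀ y σ, ξ y σ / ∑ τ, ξ y τ ≠ 0 → ξ y σ ≠ 0 := fun y σ h h' => h (by simp [h'])
  have hsupp : ∀ y ∈ sphere (0 : Fin (n + 1) → ℝ) 1, ∀ σ, ξ y σ ≠ 0 → ∀ a ∈ σ, g y (v a) ≠ 0 :=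
    fun y hy σ hσ a ha => (hmemU _ y hy).1 (hρU a y hy ((hξne y σ hσ).2.1 a ha))
  have hreal : RealOn univ (sphere (0 : Fin (n + 1) → ℝ) 1) fun y σ => ξ y σ / ∑ τ, ξ y τ := by
    refine ⟨Finset.univ, subset_univ _, fun σ => ?_, fun y hy => ⟨fun σ => ?_, fun σ hσ => ?_, ?_, ?_⟩⟩
    · refine (hξc σ).continuousOn.div (continuous_finsetSum _ fun τ _ => hξc τ).continuousOn
        fun y hy => (hsum y hy).ne'
    · exact div_nonneg (hξ0 y σ) (hsum y hy).le
    · exact absurd (Finset.mem_univ σ) hσ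
    · rw [← Finset.sum_div, div_self (hsum y hy).ne']
    · intro σ hσ τ hτ _
      have h1 := (hξne y σ (hxne y σ hσ)).2.2
      have h2 := (hξne y τ (hxne y τ hτ)).2.2
      by_contra! hn
      obtain ⟨a, ha, ha'⟩ := Finset.not_subset.1 hn.1
      obtain ⟨b, hb, hb'⟩ := Finset.not_subset.1 hn.2
      exact lt_asymm (h1 a ha b hb') (h2 b hb a ha')
  refine ⟨W, inferInstance, v, _, hreal.of_support fun y hy σ hσ => ?_,
    fun y hy σ hσ => hsupp y hy σ (hxne y σ hσ)⟩
  have hσ' := hxne y σ hσ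
  refine ⟨(hξne y σ hσ').1, hρcard y hy σ (hξne y σ hσ').2.1, ?_, fun a ha => ?_⟩
  · refine (hb y hy).isChain.mono ?_
    rintro _ ⟨a, ha, rfl⟩
    exact hsupp y hy σ hσ' a ha
  · exact hQ ((hb y hy).mem_of_ne_zero (hsupp y hy σ hσ' a ha))

end NerveApproximation

section SeqCarrier

open Set Metric Topology

variable {V : Type*} {F : Set (OSeq V)} {X : Set V}

lemma OSeq.le_iff {a b : OSeq V} : a ≤ b ↔ a.1.Sublist b.1 := Iff.rfl

lemma OSeq.mem_of_le {a b : OSeq V} (h : a ≤ b) {x : V} (hx : x ∈ a.1) : x ∈ b.1 :=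
  List.Sublist.subset h hx

lemma mem_seqExt_iff {v w : OSeq V} :
    w ∈ SeqExt F v ↔ w ∈ F ∧ ∃ u ∈ F, u.1 = w.1 ++ v.1 := by
  refine and_congr_right fun _ => ⟨fun ⟨h, hm⟩ => ⟨_, hm, rfl⟩, fun ⟨u, hu, he⟩ => ?_⟩
  exact ⟨he ▸ u.2, (Subtype.ext he : u = ⟨_, he ▸ u.2⟩) ▸ hu⟩

/-- A nonempty sublist of a sequence, as a sequence. -/
def OSeq.ofSublist (u : OSeq V) (l : List V) (hl : l ≠ []) (h : l.Sublist u.1) : OSeq V :=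
  ⟨l, hl, h.nodup u.2.2⟩

lemma OSeq.append_ne_nil (w v : OSeq V) : w.1 ++ v.1 ≠ [] := List.append_ne_nil_of_left_ne_nil w.2.1 _

lemma ChainCondition.exists_append (hF : ChainCondition F) {w v v' u : OSeq V} (hu : u ∈ F)
    (he : u.1 = w.1 ++ v'.1) (hv : v ≤ v') : ∃ u' ∈ F, u'.1 = w.1 ++ v.1 := by
  have hsub : (w.1 ++ v.1).Sublist u.1 := he ▸ (List.Sublist.refl _).append hv
  exact ⟨u.ofSublist _ (w.append_ne_nil v) hsub, hF (show _ ≤ u from hsub) hu, rfl⟩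

lemma seqExt_anti (hF : ChainCondition F) {v v' : OSeq V} (hv : v ≤ v') :
    SeqExt F v' ⊆ SeqExt F v := by
  intro w hw
  rw [mem_seqExt_iff] at hw ⊢
  obtain ⟨hwF, u, hu, he⟩ := hw
  exact ⟨hwF, hF.exists_append hu he hv⟩

lemma mem_seqIn_of_le {v w : OSeq V} (h : w ≤ v) (hv : v ∈ SeqIn X) : w ∈ SeqIn X :=
  fun x hx => hv x (OSeq.mem_of_le h hx)

variable {P : Type*} {φ : P → OSeq V} {G : Set P} {c : Finset (P × Bool)}

/-- The elements of `c` at the bottom level, or whose label is a sequence in `X`. -/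
def loFaces (X : Set V) (φ : P → OSeq V) (c : Finset (P × Bool)) : Set P :=
  {σ | (σ, false) ∈ c ∨ ((σ, true) ∈ c ∧ φ σ ∈ SeqIn X)}

/-- The elements of `c` at the top level whose label is not a sequence in `X`. -/
def hiFaces (X : Set V) (φ : P → OSeq V) (c : Finset (P × Bool)) : Set P :=
  {σ | (σ, true) ∈ c ∧ φ σ ∉ SeqIn X}

/-- The carrier used to deform the labels `φ` into sequences in `X`. -/
def seqCarrier (F : Set (OSeq V)) (X : Set V) (φ : P → OSeq V) (c : Finset (P × Bool)) :
    Set (OSeq V) :=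
  {w | (∃ σ ∈ loFaces X φ c, w = φ σ) ∨ (∃ τ ∈ hiFaces X φ c, w ∈ SeqIn X ∩ SeqExt F (φ τ)) ∨
    ∃ σ ∈ loFaces X φ c, ∃ τ ∈ hiFaces X φ c, ∃ z ∈ SeqIn X ∩ SeqExt F (φ τ), w.1 = z.1 ++ (φ σ).1}

lemma seqCarrier_mono : Monotone (seqCarrier F X φ) := by
  intro c c' h
  have hlo : loFaces X φ c ⊆ loFaces X φ c' := fun σ hσ => hσ.imp (h ·) fun h' => ⟨h h'.1, h'.2⟩
  have hhi : hiFaces X φ c ⊆ hiFaces X φ c' := fun σ hσ => ⟨h hσ.1, hσ.2⟩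
  rintro w (⟨σ, hσ, hw⟩ | ⟨τ, hτ, hw⟩ | ⟨σ, hσ, τ, hτ, hw⟩)
  · exact Or.inl ⟨σ, hlo hσ, hw⟩
  · exact Or.inr (Or.inl ⟨τ, hhi hτ, hw⟩)
  · exact Or.inr (Or.inr ⟨σ, hlo hσ, τ, hhi hτ, hw⟩)

lemma exists_mem_of_mem_loFaces {σ : P} (h : σ ∈ loFaces X φ c) : ∃ ε, (σ, ε) ∈ c :=
  h.elim (fun h => ⟨_, h⟩) fun h => ⟨_, h.1⟩

lemma mem_of_mem_loFaces (hG : ∀ p ∈ c, p.1 ∈ G) {σ : P} (h : σ ∈ loFaces X φ c) : σ ∈ G :=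
  let ⟨_, h⟩ := exists_mem_of_mem_loFaces h
  hG _ h

lemma seqCarrier_subset_seqIn (htop : ∀ p ∈ c, p.2 = true) : seqCarrier F X φ c ⊆ SeqIn X := by
  have hlo : ∀ σ ∈ loFaces X φ c, φ σ ∈ SeqIn X := by
    rintro σ (h | h)
    · exact absurd (htop _ h) (by simp)
    · exact h.2
  rintro w (⟨σ, hσ, rfl⟩ | ⟨τ, hτ, hw⟩ | ⟨σ, hσ, τ, hτ, z, hz, hw⟩)
  · exact hlo σ hσ
  · exact hw.1
  · intro x hx
    rw [hw, List.mem_append] at hx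
    exact hx.elim (hz.1 x) (hlo σ hσ x)

lemma exists_of_mem_seqCarrier (hbot : ∀ p ∈ c, p.2 = false) {w : OSeq V}
    (hw : w ∈ seqCarrier F X φ c) : ∃ σ, (σ, false) ∈ c ∧ w = φ σ := by
  have hhi : ∀ τ, τ ∉ hiFaces X φ c := fun τ h => absurd (hbot _ h.1) (by simp)
  rcases hw with ⟨σ, hσ, rfl⟩ | ⟨τ, hτ, -⟩ | ⟨-, -, τ, hτ, -⟩
  · refine ⟨σ, hσ.resolve_right fun h => absurd (hbot _ h.1) (by simp), rfl⟩
  · exact absurd hτ (hhi τ)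
  · exact absurd hτ (hhi τ)

variable [PartialOrder P]

lemma loFaces_le_hiFaces (hφ : MonotoneOn φ G) (hG : ∀ p ∈ c, p.1 ∈ G)
    (hc : IsChain (· ≤ ·) (c : Set (P × Bool))) {σ τ : P} (hσ : σ ∈ loFaces X φ c)
    (hτ : τ ∈ hiFaces X φ c) : σ ≤ τ := by
  rcases hσ with hσ | ⟨hσ, hσX⟩
  · rcases hc.total hσ hτ.1 with h | h
    · exact h.1
    · exact absurd h.2 (by simp)
  · rcases hc.total hσ hτ.1 with h | h
    · exact h.1
    · exact absurd (mem_seqIn_of_le (hφ (hG _ hτ.1) (hG _ hσ) h.1) hσX) hτ.2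

lemma seqCarrier_subset (hF : ChainCondition F) (hφ : MonotoneOn φ G) (hφF : MapsTo φ G F)
    (hG : ∀ p ∈ c, p.1 ∈ G) (hc : IsChain (· ≤ ·) (c : Set (P × Bool))) :
    seqCarrier F X φ c ⊆ F := by
  rintro w (⟨σ, hσ, rfl⟩ | ⟨τ, hτ, hw⟩ | ⟨σ, hσ, τ, hτ, z, hz, hw⟩)
  · exact hφF (mem_of_mem_loFaces hG hσ)
  · exact hw.2.1
  · obtain ⟨-, u, hu, he⟩ := mem_seqExt_iff.1 hz.2
    obtain ⟨u', hu', he'⟩ := hF.exists_append hu he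
      (hφ (mem_of_mem_loFaces hG hσ) (hG _ hτ.1) (loFaces_le_hiFaces hφ hG hc hσ hτ))
    exact (Subtype.ext (he'.trans hw.symm) : u' = w) ▸ hu'

open Classical in
/-- Move the entries of `v` to the end of a sequence. -/
noncomputable def OSeq.joinRight (v z : OSeq V) : OSeq V :=
  ⟨z.1.filter (· ∉ v.1) ++ v.1, List.append_ne_nil_of_right_ne_nil _ v.2.1,
    (z.2.2.filter _).append v.2.2 fun x hx hx' => by simp [hx'] at hx⟩

lemma OSeq.joinRight_mono (v : OSeq V) : Monotone v.joinRight := fun _ _ h =>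
  List.Sublist.append (List.Sublist.filter _ h) (List.Sublist.refl _)

lemma OSeq.le_joinRight (v z : OSeq V) : v ≤ v.joinRight z := List.sublist_append_right _ _

lemma OSeq.joinRight_eq {v z z₁ : OSeq V} {l : List V} (hz : z.1 = z₁.1 ++ l) (hl : l.Sublist v.1)
    (hd : z₁.1.Disjoint v.1) : (v.joinRight z).1 = z₁.1 ++ v.1 ∧ z ≤ v.joinRight z := by
  classical
  have h : (v.joinRight z).1 = z₁.1 ++ v.1 := by
    have h1 : z₁.1.filter (· ∉ v.1) = z₁.1 := List.filter_eq_self.2 fun x hx => by simpa using hd hx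
    have h2 : l.filter (· ∉ v.1) = [] := List.filter_eq_nil_iff.2 fun x hx => by
      simpa using hl.subset hx
    simp only [OSeq.joinRight, hz, List.filter_append]
    rw [h1, h2, List.append_nil]
  refine ⟨h, ?_⟩
  rw [OSeq.le_iff, h, hz]
  exact (List.Sublist.refl _).append hl

lemma OSeq.joinRight_eq_of_le {v z : OSeq V} (hz : z ≤ v) : v.joinRight z = v := by
  classical
  refine Subtype.ext ?_
  have h2 : z.1.filter (· ∉ v.1) = [] := List.filter_eq_nil_iff.2 fun x hx => by
    simpa using OSeq.mem_of_le hz hx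
  simp only [OSeq.joinRight]
  rw [h2, List.nil_append]

lemma disjoint_of_mem_seqExt {v v' z : OSeq V} (hz : z ∈ SeqExt F v') (hv : v ≤ v') :
    z.1.Disjoint v.1 := by
  obtain ⟨-, u, -, he⟩ := mem_seqExt_iff.1 hz
  have := u.2.2
  rw [he] at this
  exact fun x hx hx' => List.disjoint_of_nodup_append this hx (OSeq.mem_of_le hv hx')

lemma exists_max_of_isChain {Q : Type*} [PartialOrder Q] {s : Set Q} (hs : s.Finite)
    (hne : s.Nonempty) (hc : IsChain (· ≤ ·) s) : ∃ m ∈ s, ∀ x ∈ s, x ≤ m := by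
  obtain ⟨m, hm⟩ := hs.exists_maximal hne
  exact ⟨m, hm.prop, fun x hx => (hc.total hx hm.prop).elim id fun h => hm.le_of_ge hx h⟩

lemma extProp_seqCarrier_of_loFaces (hφ : MonotoneOn φ G)
    (hG : ∀ p ∈ c, p.1 ∈ G) (hc : IsChain (· ≤ ·) (c : Set (P × Bool)))
    (hne : (loFaces X φ c).Nonempty) (k : ℕ) : ExtProp (seqCarrier F X φ c) k := by
  classical
  have hfin : (loFaces X φ c).Finite :=
    (c.finite_toSet.image Prod.fst).subset fun σ hσ =>
      let ⟨ε, h⟩ := exists_mem_of_mem_loFaces hσ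
      ⟨(σ, ε), h, rfl⟩
  have hchain : IsChain (· ≤ ·) (loFaces X φ c) := fun σ hσ τ hτ _ => by
    obtain ⟨ε, h⟩ := exists_mem_of_mem_loFaces hσ
    obtain ⟨ε', h'⟩ := exists_mem_of_mem_loFaces hτ
    exact (hc.total h h').imp (fun h => h.1) fun h => h.1
  obtain ⟨m, hm, hmax⟩ := exists_max_of_isChain hfin hne hchain
  have hmG := mem_of_mem_loFaces hG hm
  have hloφ : ∀ σ ∈ loFaces X φ c, φ σ ≤ φ m := fun σ hσ =>
    hφ (mem_of_mem_loFaces hG hσ) hmG (hmax σ hσ)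
  have hhiφ : ∀ τ ∈ hiFaces X φ c, φ m ≤ φ τ := fun τ hτ =>
    hφ hmG (hG _ hτ.1) (loFaces_le_hiFaces hφ hG hc hm hτ)
  have key : ∀ z ∈ seqCarrier F X φ c,
      (φ m).joinRight z ∈ seqCarrier F X φ c ∧ z ≤ (φ m).joinRight z := by
    rintro z (⟨σ, hσ, rfl⟩ | ⟨τ, hτ, hz⟩ | ⟨σ, hσ, τ, hτ, z₁, hz₁, hz⟩)
    · rw [OSeq.joinRight_eq_of_le (hloφ σ hσ)]
      exact ⟨Or.inl ⟨m, hm, rfl⟩, hloφ σ hσ⟩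
    · obtain ⟨h1, h2⟩ := OSeq.joinRight_eq (v := φ m) (z := z) (l := []) (by simp)
        (List.nil_sublist _) (disjoint_of_mem_seqExt hz.2 (hhiφ τ hτ))
      exact ⟨Or.inr (Or.inr ⟨m, hm, τ, hτ, z, hz, h1⟩), h2⟩
    · obtain ⟨h1, h2⟩ := OSeq.joinRight_eq hz (hloφ σ hσ)
        (disjoint_of_mem_seqExt hz₁.2 (hhiφ τ hτ))
      exact ⟨Or.inr (Or.inr ⟨m, hm, τ, hτ, z₁, hz₁, h1⟩), h2⟩
  exact extProp_of_conical ((φ m).joinRight_mono.monotoneOn _) (fun z hz => (key z hz).1)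
    (Or.inl ⟨m, hm, rfl⟩) (fun z hz => (key z hz).2) (fun z _ => (φ m).le_joinRight z) k

lemma seqCarrier_eq_of_loFaces_eq_empty (hF : ChainCondition F) (hφ : MonotoneOn φ G)
    (hG : ∀ p ∈ c, p.1 ∈ G) (hlo : loFaces X φ c = ∅) {m : P} (hm : m ∈ hiFaces X φ c)
    (hmin : ∀ τ ∈ hiFaces X φ c, m ≤ τ) :
    seqCarrier F X φ c = SeqIn X ∩ SeqExt F (φ m) := by
  refine Subset.antisymm ?_ fun w hw => Or.inr (Or.inl ⟨m, hm, hw⟩)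
  rintro w (⟨σ, hσ, -⟩ | ⟨τ, hτ, hw⟩ | ⟨σ, hσ, -⟩)
  · exact absurd hσ (hlo ▸ notMem_empty σ)
  · exact ⟨hw.1, seqExt_anti hF (hφ (hG _ hm.1) (hG _ hτ.1) (hmin τ hτ)) hw.2⟩
  · exact absurd hσ (hlo ▸ notMem_empty σ)

/-- Labels of the simplices of a complex whose vertices are labelled by sequences: the longest
sequence among the vertices of the simplex, and its subsequence of heads of vertices. -/
lemma exists_labels {W : Type*} [Nonempty (OSeq V)] (v : W → OSeq V) :
    ∃ top φ : Finset W → OSeq V,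
      (∀ σ : Finset W, σ.Nonempty → IsChain (· ≤ ·) (v '' σ) →
        top σ ∈ v '' σ ∧ (∀ a ∈ σ, v a ≤ top σ) ∧ φ σ ≤ top σ ∧ (φ σ).1.length ≤ σ.card) ∧
      ∀ σ τ : Finset W, σ.Nonempty → IsChain (· ≤ ·) (v '' σ) → IsChain (· ≤ ·) (v '' τ) →
        σ ⊆ τ → φ σ ≤ φ τ := by
  classical
  have htop : ∀ σ : Finset W, ∃ t : OSeq V, σ.Nonempty → IsChain (· ≤ ·) (v '' σ) →
      t ∈ v '' σ ∧ ∀ a ∈ σ, v a ≤ t := fun σ => by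
    by_cases h : σ.Nonempty ∧ IsChain (· ≤ ·) (v '' σ)
    · obtain ⟨t, ht, hmax⟩ := exists_max_of_isChain (σ.finite_toSet.image v)
        (h.1.to_set.image v) h.2
      exact ⟨t, fun _ _ => ⟨ht, fun a ha => hmax _ (mem_image_of_mem v ha)⟩⟩
    · exact ⟨Classical.arbitrary _, fun h1 h2 => absurd ⟨h1, h2⟩ h⟩
  choose top htop using htop
  let head : W → V := fun a => (v a).1.head (v a).2.1
  let l : Finset W → List V := fun σ => (top σ).1.filter (· ∈ σ.image head)
  have hφ : ∀ σ : Finset W, ∃ w : OSeq V, σ.Nonempty → IsChain (· ≤ ·) (v '' σ) → w.1 = l σ := by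
    intro σ
    by_cases h : σ.Nonempty ∧ IsChain (· ≤ ·) (v '' σ)
    · obtain ⟨⟨a, ha, hat⟩, -⟩ := htop σ h.1 h.2
      refine ⟨⟨l σ, List.ne_nil_of_mem (a := head a) ?_, (top σ).2.2.filter _⟩, fun _ _ => rfl⟩
      refine List.mem_filter.2 ⟨hat ▸ List.head_mem _, ?_⟩
      simpa using ⟨a, ha, rfl⟩
    · exact ⟨Classical.arbitrary _, fun h1 h2 => absurd ⟨h1, h2⟩ h⟩
  choose φ hφ using hφ
  refine ⟨top, φ, fun σ hσ hc => ⟨(htop σ hσ hc).1, (htop σ hσ hc).2, ?_, ?_⟩,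
    fun σ τ hσ hc hc' hle => ?_⟩
  · rw [OSeq.le_iff, hφ σ hσ hc]
    exact List.filter_sublist
  · rw [hφ σ hσ hc, ← List.toFinset_card_of_nodup ((top σ).2.2.filter _)]
    refine (Finset.card_le_card fun x hx => ?_).trans (Finset.card_image_le (s := σ) (f := head))
    simpa using (List.mem_filter.1 (List.mem_toFinset.1 hx)).2
  · rw [OSeq.le_iff, hφ σ hσ hc, hφ τ (hσ.mono hle) hc']
    obtain ⟨a, ha, hat⟩ := (htop σ hσ hc).1
    have h1 : top σ ≤ top τ := hat ▸ (htop τ (hσ.mono hle) hc').2 a (hle ha)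
    refine (List.Sublist.filter _ h1).trans (List.monotone_filter_right _ fun x hx => ?_)
    have hx' : x ∈ σ.image head := by simpa using hx
    simpa using Finset.image_subset_image hle hx'

end SeqCarrier

section LinkLemma

open Set Metric Topology

variable {V : Type*} {F : Set (OSeq V)} {X : Set V}

lemma extProp_seqCarrier {W : Type*} {φ : Finset W → OSeq V} {G : Set (Finset W)} {n : ℕ}
    (hF : ChainCondition F)
    (hext : ∀ v ∈ F, v ∉ SeqIn X → ∀ k : ℕ, k + v.1.length ≤ n + 1 →
      ExtProp (SeqIn X ∩ SeqExt F v) k)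
    (hφ : MonotoneOn φ G) (hφF : MapsTo φ G F)
    (hcard : ∀ σ ∈ G, σ.card ≤ n + 1 ∧ (φ σ).1.length ≤ σ.card)
    {c : Finset (Finset W × Bool)} (hG : ∀ p ∈ c, p.1 ∈ G)
    (hc : IsChain (· ≤ ·) (c : Set (Finset W × Bool))) {k : ℕ} (hk : c.card = k + 1) :
    ExtProp (seqCarrier F X φ c) k := by
  classical
  rcases (loFaces X φ c).eq_empty_or_nonempty with hlo | hlo
  swap
  · exact extProp_seqCarrier_of_loFaces hφ hG hc hlo k
  have hhi : ∀ p ∈ c, p.2 = true ∧ p.1 ∈ hiFaces X φ c := by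
    rintro ⟨σ, ε⟩ hp
    have hσ : σ ∉ loFaces X φ c := hlo ▸ notMem_empty σ
    cases ε
    · exact absurd (Or.inl hp) hσ
    · exact ⟨rfl, hp, fun h => hσ (Or.inr ⟨hp, h⟩)⟩
  have hne : c.Nonempty := Finset.card_pos.1 (by omega)
  obtain ⟨p₀, hp₀, hmin⟩ := c.exists_min_image (fun p => p.1.card) hne
  have hcmp : ∀ p ∈ c, ∀ q ∈ c, p.1.card ≤ q.1.card → p ≤ q := by
    intro p hp q hq hle
    rcases hc.total hp hq with h | h
    · exact h
    · exact ⟨(Finset.eq_of_subset_of_card_le h.1 hle).ge, by rw [(hhi p hp).1, (hhi q hq).1]⟩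
  have hle : c.card ≤ (Finset.Icc p₀.1.card (n + 1)).card :=
    Finset.card_le_card_of_injOn (fun p => p.1.card)
      (fun p hp => Finset.mem_coe.2 (Finset.mem_Icc.2 ⟨hmin p hp, (hcard _ (hG p hp)).1⟩))
      fun p hp q hq h => le_antisymm (hcmp p hp q hq h.le) (hcmp q hq p hp h.ge)
  rw [Nat.card_Icc] at hle
  rw [seqCarrier_eq_of_loFaces_eq_empty hF hφ hG hlo (hhi p₀ hp₀).2
    fun τ hτ => (hcmp p₀ hp₀ (τ, true) hτ.1 (hmin _ hτ.1)).1]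
  have h1 := hcard _ (hG p₀ hp₀)
  exact hext _ (hφF (hG p₀ hp₀)) (hhi p₀ hp₀).2.2 k (by omega)

/-- If the links of the sequences of `F` outside `O(X)` are highly connected, and `O(X) ∩ F` is
contained in the link of a sequence `y`, then spheres in `F` are nullhomotopic. -/
lemma extProp_of_links {n : ℕ} (hF : ChainCondition F)
    (hext : ∀ v ∈ F, v ∉ SeqIn X → ∀ k : ℕ, k + v.1.length ≤ n + 1 →
      ExtProp (SeqIn X ∩ SeqExt F v) k)
    {y : OSeq V} (hy : y ∈ F) (hXy : SeqIn X ∩ F ⊆ SeqExt F y) : ExtProp F (n + 1) := by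
  classical
  intro g hg
  obtain ⟨W, _, v, x, hx, hsupp⟩ := exists_nerve_approximation hg
  have : Nonempty (OSeq V) := ⟨y⟩
  obtain ⟨top, φ, hlab, hφmono⟩ := exists_labels v
  set G : Set (Finset W) := {σ : Finset W | σ.Nonempty ∧ σ.card ≤ n + 1 ∧
    IsChain (· ≤ ·) (v '' σ) ∧ ∀ a ∈ σ, v a ∈ F} with hGdef
  have htopF : MapsTo top G F := fun σ hσ => by
    obtain ⟨a, ha, hat⟩ := (hlab σ hσ.1 hσ.2.2.1).1
    exact hat ▸ hσ.2.2.2 a ha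
  have hφtop : ∀ σ ∈ G, φ σ ≤ top σ := fun σ hσ => (hlab σ hσ.1 hσ.2.2.1).2.2.1
  have hφF : MapsTo φ G F := fun σ hσ => hF (hφtop σ hσ) (htopF hσ)
  have hφ : MonotoneOn φ G := fun σ hσ τ hτ h => hφmono σ τ hσ.1 hσ.2.2.1 hτ.2.2.1 h
  have htop : MonotoneOn top G := fun σ hσ τ hτ h => by
    obtain ⟨a, ha, hat⟩ := (hlab σ hσ.1 hσ.2.2.1).1
    exact hat ▸ (hlab τ hτ.1 hτ.2.2.1).2.1 a (h ha)
  let 𝒦 : Set (Finset (Finset W × Bool)) :=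
    {c | IsChain (· ≤ ·) (c : Set (Finset W × Bool)) ∧ ∀ p ∈ c, p.1 ∈ G}
  obtain ⟨Ψ, hΨ⟩ := exists_carried (𝒦 := 𝒦) (C := seqCarrier F X φ)
    (fun c hc c' h => ⟨hc.1.mono (Finset.coe_subset.2 h), fun p hp => hc.2 p (h hp)⟩)
    seqCarrier_mono fun c hc k hk => extProp_seqCarrier hF hext hφ hφF
      (fun σ hσ => ⟨hσ.2.1, (hlab σ hσ.1 hσ.2.2.1).2.2.2⟩) hc.2 hc.1 hk
  obtain ⟨Q, hQ, hcont, hb⟩ := hx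
  let S : Set (Fin (n + 1) → ℝ) := sphere 0 1
  have hpair : ∀ ε : Bool, MonotoneOn (fun σ : Finset W => (σ, ε)) G :=
    fun ε σ _ τ _ h => ⟨h, le_rfl⟩
  have hpairG : ∀ ε : Bool, MapsTo (fun σ : Finset W => (σ, ε)) G {p | p.1 ∈ G} :=
    fun ε σ hσ => hσ
  have carried : ∀ {E : Type} [TopologicalSpace E] {Z : Set E} {u : E → Finset W × Bool → ℝ}
      {A : Set (OSeq V)}, RealOn {p : Finset W × Bool | p.1 ∈ G} Z u →
      (∀ z ∈ Z, ∀ c ∈ 𝒦, (∀ p ∈ c, u z p ≠ 0) → seqCarrier F X φ c ⊆ A) →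
      RealOn A Z fun z => Ψ (u z) := by
    rintro E _ Z u A ⟨R, hR, hu, hub⟩ hA
    refine RealOn.comp_carried hΨ hu fun z hz => ?_
    have hmem : R.filter (fun p => u z p ≠ 0) ∈ 𝒦 :=
      ⟨(hub z hz).isChain.mono fun p hp => (Finset.mem_filter.1 hp).2,
        fun p hp => hR (Finset.mem_filter.1 hp).1⟩
    exact ⟨_, hmem, hA z hz _ hmem fun p hp => (Finset.mem_filter.1 hp).2,
      (hub z hz).mem_simplexFace fun p hp =>
        Finset.mem_filter.2 ⟨(hub z hz).mem_of_ne_zero hp, hp⟩⟩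
  have hCF : ∀ c ∈ 𝒦, seqCarrier F X φ c ⊆ F := fun c hc =>
    seqCarrier_subset hF hφ hφF hc.2 hc.1
  have hpush : ∀ ε : Bool, RealOn {p : Finset W × Bool | p.1 ∈ G} S
      fun z => pushWeight Q (fun σ => (σ, ε)) (x z) := fun ε =>
    RealOn.pushWeight hQ hcont hb (hpair ε) (hpairG ε)
  have htopx : RealOn F S fun z => pushWeight Q top (x z) :=
    RealOn.pushWeight hQ hcont hb htop htopF
  have hφx : RealOn F S fun z => pushWeight Q φ (x z) :=
    RealOn.pushWeight hQ hcont hb hφ hφF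
  have H₁ : RealHtpy F S g fun z => pushWeight Q top (x z) := by
    refine RealHtpy.of_isChain hg htopx fun z hz => ?_
    obtain ⟨R, -, -, hgb⟩ := hg
    refine (hgb z hz).isChain.mono (union_subset subset_rfl fun w hw => ?_)
    obtain ⟨σ, hσ, hne, rfl⟩ := exists_of_pushWeight_ne_zero hw
    obtain ⟨a, ha, hat⟩ := (hlab σ (hQ hσ).1 (hQ hσ).2.2.1).1
    exact hat ▸ hsupp z hz σ hne a ha
  have H₂ : RealHtpy F S (fun z => pushWeight Q top (x z)) fun z => pushWeight Q φ (x z) :=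
    (RealHtpy.pushWeight hQ hcont hb hφ htop hφtop hφF htopF).symm
  have hΨ₀ : RealOn F S fun z => Ψ (pushWeight Q (fun σ => (σ, false)) (x z)) :=
    carried (hpush false) fun z _ c hc _ => hCF c hc
  have hΨ₀supp : ∀ z ∈ S, ∀ w, Ψ (pushWeight Q (fun σ => (σ, false)) (x z)) w ≠ 0 →
      ∃ σ ∈ Q, x z σ ≠ 0 ∧ w = φ σ := by
    intro z hz w hw
    have h := carried (Z := {z}) (A := {w | ∃ σ ∈ Q, x z σ ≠ 0 ∧ w = φ σ})
      ((hpush false).mono_right (singleton_subset_iff.2 hz)) fun z' hz' c _ hne w₁ hw₁ => by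
        obtain rfl : z' = z := hz'
        have hne' : ∀ p ∈ c, ∃ σ ∈ Q, x z' σ ≠ 0 ∧ (σ, false) = p := fun p hp =>
          exists_of_pushWeight_ne_zero (hne p hp)
        obtain ⟨σ, hσ, rfl⟩ := exists_of_mem_seqCarrier (fun p hp => by
          obtain ⟨σ, -, -, rfl⟩ := hne' p hp
          rfl) hw₁
        obtain ⟨σ', h1, h2, h3⟩ := hne' _ hσ
        obtain rfl : σ' = σ := congrArg Prod.fst h3
        exact ⟨σ', h1, h2, rfl⟩
    exact h.mem_of_ne_zero (mem_singleton z) hw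
  have H₃ : RealHtpy F S (fun z => pushWeight Q φ (x z))
      fun z => Ψ (pushWeight Q (fun σ => (σ, false)) (x z)) := by
    refine RealHtpy.of_isChain hφx hΨ₀ fun z hz => ?_
    have hsub : {p | pushWeight Q φ (x z) p ≠ 0} ∪
        {p | Ψ (pushWeight Q (fun σ => (σ, false)) (x z)) p ≠ 0} ⊆
        {w | ∃ σ ∈ Q, x z σ ≠ 0 ∧ w = φ σ} := by
      refine union_subset (fun w hw => ?_) fun w hw => hΨ₀supp z hz w hw
      obtain ⟨σ, hσ, hne, rfl⟩ := exists_of_pushWeight_ne_zero hw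
      exact ⟨σ, hσ, hne, rfl⟩
    refine IsChain.mono hsub ?_
    rintro _ ⟨σ, hσ, hne, rfl⟩ _ ⟨τ, hτ, hne', rfl⟩ -
    exact ((hb z hz).isChain.total hne hne').imp (hφ (hQ hσ) (hQ hτ)) (hφ (hQ hτ) (hQ hσ))
  have H₄ : RealHtpy F S (fun z => Ψ (pushWeight Q (fun σ => (σ, false)) (x z)))
      fun z => Ψ (pushWeight Q (fun σ => (σ, true)) (x z)) := by
    obtain ⟨H, hH, h0, h1⟩ := RealHtpy.pushWeight hQ hcont hb (hpair false) (hpair true)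
      (fun σ _ => ⟨le_rfl, Bool.false_le _⟩) (hpairG false) (hpairG true)
    exact ⟨fun w => Ψ (H w), carried hH fun z _ c hc _ => hCF c hc,
      fun z hz => congrArg Ψ (h0 z hz), fun z hz => congrArg Ψ (h1 z hz)⟩
  have hΨ₁ : RealOn (SeqIn X ∩ F) S fun z => Ψ (pushWeight Q (fun σ => (σ, true)) (x z)) :=
    carried (hpush true) fun z _ c hc hne => by
      refine subset_inter (seqCarrier_subset_seqIn fun p hp => ?_) (hCF c hc)
      obtain ⟨σ, -, -, rfl⟩ := exists_of_pushWeight_ne_zero (hne p hp)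
      rfl
  have hjoin : ∀ w : OSeq V, ∃ u : OSeq V, w ∈ SeqIn X ∩ F → u ∈ F ∧ u.1 = w.1 ++ y.1 := fun w => by
    by_cases hw : w ∈ SeqIn X ∩ F
    · obtain ⟨-, u, hu⟩ := mem_seqExt_iff.1 (hXy hw)
      exact ⟨u, fun _ => hu⟩
    · exact ⟨w, fun h => absurd h hw⟩
  choose join hjoin using hjoin
  refine H₁.extendsToBall (H₂.extendsToBall (H₃.extendsToBall (H₄.extendsToBall
    (extendsToBall_of_conical inter_subset_right (h := join) ?_ (fun w hw => (hjoin w hw).1)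
      hy ?_ ?_ hΨ₁))))
  · intro w hw w' hw' h
    rw [OSeq.le_iff, (hjoin w hw).2, (hjoin w' hw').2]
    exact List.Sublist.append h (List.Sublist.refl _)
  · intro w hw
    rw [OSeq.le_iff, (hjoin w hw).2]
    exact List.sublist_append_left _ _
  · intro w hw
    rw [OSeq.le_iff, (hjoin w hw).2]
    exact List.sublist_append_right _ _

end LinkLemma

namespace NerveRealization

open Set Metric Topology

section Compact

variable {P : Type} [PartialOrder P] {K : Type*} [TopologicalSpace K]

lemma isClosed_of_finite {D : Set (Realization P)} (hD : D.Finite) : IsClosed D := by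
  rw [← biUnion_of_singleton D]
  refine hD.isClosed_biUnion fun x _ => ?_
  have h : ({x} : Set (Realization P)) = ⋂ p, weight p ⁻¹' {weight p x} := by
    ext y
    simp only [mem_singleton_iff, mem_iInter, mem_preimage]
    exact ⟨fun h p => h ▸ rfl, weight_injective⟩
  rw [h]
  exact isClosed_iInter fun p => isClosed_singleton.preimage (weight p).continuous

/-- A compact family of points of the realization is supported on finitely many elements. -/
lemma realOn_weight [CompactSpace K] {f : K → Realization P} (hf : Continuous f) :
    RealOn univ univ fun k p => weight p (f k) := by
  classical
  choose supp hb hne using exists_isBarycentric_weight (P := P)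
  have hchoose : ∀ s : range (supp ∘ f), ∃ k, supp (f k) = s := fun s => s.2
  choose κ hκ using hchoose
  let D : Set (Realization P) := range (f ∘ κ)
  have hinj : InjOn supp D := by
    rintro _ ⟨s, rfl⟩ _ ⟨s', rfl⟩ h
    have h' : (s : Finset P) = s' := (hκ s).symm.trans (h.trans (hκ s'))
    rw [Subtype.ext h']
  have hclosed : ∀ D' ⊆ D, IsClosed D' := fun D' hD' => isClosed_of_cells fun {n} c => by
    let S : Set (Realization P) := {z | z ∈ D' ∧ supp z ∈ (Finset.univ.image c).powerset}
    have hS : S.Finite := Finite.of_finite_image (f := supp)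
      ((Finset.univ.image c).powerset.finite_toSet.subset
        (image_subset_iff.2 fun z hz => Finset.mem_coe.2 hz.2))
      (hinj.mono fun z hz => hD' hz.1)
    convert (isClosed_of_finite hS).preimage (cell c).continuous using 1
    ext t
    refine ⟨fun ht => ⟨ht, Finset.mem_powerset.2 fun p hp => ?_⟩, fun ht => ht.1⟩
    by_contra hn
    exact hne _ p hp (weight_cell_of_notMem t fun ⟨i, hi⟩ =>
      hn (Finset.mem_image.2 ⟨i, Finset.mem_univ _, hi⟩))
  have hcomp : IsCompact D := (isCompact_range hf).of_isClosed_subset (hclosed D subset_rfl)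
    (range_comp_subset_range _ _)
  have hfin : D.Finite := hcomp.finite
    (isDiscrete_iff_forall_mem_exists_isClosed.2 fun D' hD' =>
      ⟨D', hclosed D' hD', inter_eq_left.2 hD'⟩)
  refine ⟨hfin.toFinset.biUnion supp, subset_univ _,
    fun p => ((weight p).continuous.comp hf).continuousOn, fun k _ => (hb (f k)).mono ?_⟩
  have hk : supp (f k) = supp (f (κ ⟨supp (f k), k, rfl⟩)) := (hκ ⟨supp (f k), k, rfl⟩).symm
  rw [hk]
  exact Finset.subset_biUnion_of_mem supp (hfin.mem_toFinset.2 ⟨_, rfl⟩)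

end Compact

section Subset

variable {T : Type} [PartialOrder T] {A : Set T} {K : Type*} [TopologicalSpace K]

open Classical in
/-- The barycentric coordinates of a point of the realization of a subset of a poset. -/
noncomputable def coord (A : Set T) (x : Realization A) (p : T) : ℝ :=
  if h : p ∈ A then weight ⟨p, h⟩ x else 0

lemma coord_coe (x : Realization A) (p : A) : coord A x p = weight p x := dif_pos p.2

lemma coord_of_notMem (x : Realization A) {p : T} (hp : p ∉ A) : coord A x p = 0 := dif_neg hp

lemma coord_injective : Function.Injective (coord A) := fun x y h =>
  weight_injective fun p => by rw [← coord_coe, ← coord_coe, h]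

lemma realOn_coord [CompactSpace K] {f : K → Realization A} (hf : Continuous f) :
    RealOn A univ fun k => coord A (f k) := by
  obtain ⟨Q, -, hcont, hb⟩ := realOn_weight hf
  refine ⟨Q.map ⟨Subtype.val, Subtype.val_injective⟩, ?_, fun p => ?_, fun k hk => ⟨fun p => ?_,
    fun p hp => ?_, ?_, ?_⟩⟩
  · intro p hp
    obtain ⟨q, -, rfl⟩ := Finset.mem_map.1 (Finset.mem_coe.1 hp)
    exact q.2
  · by_cases hp : p ∈ A
    · simpa only [coord, dif_pos hp] using hcont ⟨p, hp⟩
    · simpa only [coord, dif_neg hp] using continuousOn_const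
  · by_cases hp : p ∈ A
    · exact ((hb k hk).nonneg ⟨p, hp⟩).trans_eq (coord_coe (f k) ⟨p, hp⟩).symm
    · exact (coord_of_notMem (f k) hp).ge
  · by_cases hpA : p ∈ A
    · refine (coord_coe (f k) ⟨p, hpA⟩).trans ((hb k hk).eq_zero _ fun h => hp ?_)
      exact Finset.mem_map.2 ⟨_, h, rfl⟩
    · exact coord_of_notMem (f k) hpA
  · rw [Finset.sum_map, ← (hb k hk).sum_eq_one]
    exact Finset.sum_congr rfl fun p _ => coord_coe (f k) p
  · have hmem : ∀ p, coord A (f k) p ≠ 0 → ∃ q : A, weight q (f k) ≠ 0 ∧ (q : T) = p := by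
      intro p hp
      by_cases hpA : p ∈ A
      · exact ⟨⟨p, hpA⟩, fun h => hp ((coord_coe (f k) ⟨p, hpA⟩).trans h), rfl⟩
      · exact absurd (coord_of_notMem (f k) hpA) hp
    intro p hp q hq _
    obtain ⟨p, hp', rfl⟩ := hmem p hp
    obtain ⟨q, hq', rfl⟩ := hmem q hq
    exact (hb k hk).isChain.total hp' hq'

lemma exists_coord_eq {g : K → T → ℝ} (hg : RealOn A univ g) :
    ∃ f : C(K, Realization A), ∀ k, coord A (f k) = g k := by
  classical
  obtain ⟨Q, hQ, hcont, hb⟩ := hg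
  have hbA : ∀ k, IsBarycentric (Q.subtype (· ∈ A)) fun p : A => g k p := fun k => by
    refine ⟨fun p => (hb k trivial).nonneg p, fun p hp => (hb k trivial).eq_zero p fun h => hp ?_,
      ?_, ?_⟩
    · exact Finset.mem_subtype.2 h
    · rw [← (hb k trivial).sum_eq_one]
      exact Finset.sum_subtype_of_mem (fun p => g k p) fun p hp => hQ hp
    · intro p hp q hq _
      exact (hb k trivial).isChain.total (x := (p : T)) (y := q) hp hq
  choose f hf using fun k => exists_weight_eq (hbA k)
  refine ⟨⟨f, continuous_of_realOn (A := univ) ⟨Q.subtype (· ∈ A), subset_univ _, fun p => ?_,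
    fun k _ => ?_⟩⟩, fun k => funext fun p => ?_⟩
  · simpa only [hf] using hcont p
  · simpa only [hf] using hbA k
  · by_cases hp : p ∈ A
    · exact (coord_coe _ ⟨p, hp⟩).trans (hf k ⟨p, hp⟩)
    · exact (coord_of_notMem _ hp).trans ((hb k trivial).eq_zero p fun h => hp (hQ h)).symm

end Subset

end NerveRealization

section Cube

open Set Metric Topology unitInterval

variable {n : ℕ}

/-- The point of the cube `[0, 1]ⁿ` corresponding to a point of `[-1, 1]ⁿ`. -/
noncomputable def toCube (y : Fin n → ℝ) : Fin n → I :=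
  fun i => projIcc 0 1 zero_le_one ((y i + 1) / 2)

/-- The point of `[-1, 1]ⁿ` corresponding to a point of the cube `[0, 1]ⁿ`. -/
def ofCube (t : Fin n → I) : Fin n → ℝ := fun i => 2 * (t i : ℝ) - 1

lemma continuous_toCube : Continuous (toCube (n := n)) :=
  continuous_pi fun i => continuous_projIcc.comp (by fun_prop)

lemma continuous_ofCube : Continuous (ofCube (n := n)) :=
  continuous_pi fun i => by unfold ofCube; fun_prop

lemma toCube_ofCube (t : Fin n → I) : toCube (ofCube t) = t := by
  ext i
  have h : (ofCube t i + 1) / 2 = t i := by simp [ofCube]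
  rw [toCube, h, projIcc_val]

lemma norm_ofCube_le (t : Fin n → I) : ‖ofCube t‖ ≤ 1 :=
  (pi_norm_le_iff_of_nonneg zero_le_one).2 fun i => abs_le.2
    ⟨by simp only [ofCube]; linarith [(t i).2.1], by simp only [ofCube]; linarith [(t i).2.2]⟩

lemma coe_toCube {y : Fin n → ℝ} (hy : ‖y‖ ≤ 1) (i : Fin n) :
    (toCube y i : ℝ) = (y i + 1) / 2 := by
  have h := abs_le.1 ((norm_le_pi_norm y i).trans hy)
  rw [toCube, projIcc_of_mem zero_le_one ⟨by linarith [h.1], by linarith [h.2]⟩]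

lemma ofCube_toCube {y : Fin n → ℝ} (hy : ‖y‖ ≤ 1) : ofCube (toCube y) = y := by
  ext i
  rw [ofCube, coe_toCube hy]
  ring

lemma exists_abs_eq_norm {y : Fin n → ℝ} (hy : ‖y‖ = 1) : ∃ i, |y i| = 1 := by
  by_contra! h
  have := (pi_norm_lt_iff (x := y) zero_lt_one).2 fun i =>
    lt_of_le_of_ne (hy ▸ norm_le_pi_norm y i) (h i)
  exact this.ne hy

lemma toCube_mem_boundary {y : Fin n → ℝ} (hy : ‖y‖ = 1) : toCube y ∈ Cube.boundary (Fin n) := by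
  obtain ⟨i, hi⟩ := exists_abs_eq_norm hy
  refine ⟨i, ?_⟩
  rcases (abs_eq zero_le_one).1 hi with h | h
  · exact Or.inr (Subtype.ext (by rw [coe_toCube hy.le, h]; norm_num))
  · exact Or.inl (Subtype.ext (by rw [coe_toCube hy.le, h]; norm_num))

lemma norm_ofCube_of_mem_boundary {t : Fin n → I} (ht : t ∈ Cube.boundary (Fin n)) :
    ‖ofCube t‖ = 1 := by
  obtain ⟨i, hi⟩ := ht
  refine le_antisymm (norm_ofCube_le t) (le_trans ?_ (norm_le_pi_norm _ i))
  rcases hi with hi | hi <;> simp only [ofCube, hi] <;> norm_num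

lemma norm_cons (a : ℝ) (y : Fin n → ℝ) : ‖(Fin.cons a y : Fin (n + 1) → ℝ)‖ = max |a| ‖y‖ := by
  apply le_antisymm
  · refine (pi_norm_le_iff_of_nonneg (by positivity)).2 (Fin.cases ?_ fun i => ?_)
    · simp
    · simpa using Or.inr (norm_le_pi_norm y i)
  · refine max_le ?_ ((pi_norm_le_iff_of_nonneg (by positivity)).2 fun i => ?_)
    · simpa using norm_le_pi_norm (Fin.cons a y : Fin (n + 1) → ℝ) 0
    · simpa using norm_le_pi_norm (Fin.cons a y : Fin (n + 1) → ℝ) i.succ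

lemma norm_eq_max_tail (y : Fin (n + 1) → ℝ) : ‖y‖ = max |y 0| ‖Fin.tail y‖ := by
  conv_lhs => rw [← Fin.cons_self_tail y]
  exact norm_cons _ _

lemma continuous_tail : Continuous (Fin.tail : (Fin (n + 1) → ℝ) → Fin n → ℝ) :=
  continuous_pi fun i => continuous_apply i.succ

end Cube

namespace NerveRealization

open Set Metric Topology unitInterval

variable {T : Type} [PartialOrder T] {A : Set T} {n : ℕ}

/-- If spheres extend to balls, then the homotopy groups vanish. -/
lemma subsingleton_homotopyGroup (h : ExtProp A (n + 1)) (x : Realization A) :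
    Subsingleton (HomotopyGroup (Fin n) (Realization A) x) := by
  classical
  suffices H : ∀ f : GenLoop (Fin n) (Realization A) x, GenLoop.Homotopic f GenLoop.const by
    refine ⟨fun a b => ?_⟩
    induction a using Quotient.inductionOn with | _ a
    induction b using Quotient.inductionOn with | _ b
    exact Quotient.sound ((H a).trans (H b).symm)
  intro f
  let g : (Fin (n + 1) → ℝ) → T → ℝ := fun y =>
    if y 0 = 1 then coord A (f (toCube (Fin.tail y))) else coord A x
  let Z₁ : Set (Fin (n + 1) → ℝ) := sphere 0 1 ∩ {y | y 0 = 1}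
  let Z₂ : Set (Fin (n + 1) → ℝ) := sphere 0 1 ∩ ({y | y 0 = -1} ∪ {y | ‖Fin.tail y‖ = 1})
  have hgx : ∀ y ∈ Z₂, g y = coord A x := by
    rintro y ⟨-, hy | hy⟩
    · exact if_neg fun h0 => by norm_num [mem_ofPred_eq, h0] at hy
    · by_cases h0 : y 0 = 1
      · rw [show g y = _ from if_pos h0, GenLoop.boundary f _ (toCube_mem_boundary hy)]
      · exact if_neg h0
  have hg₁ : RealOn A Z₁ g :=
    ((realOn_coord f.1.continuous).comp (continuous_toCube.comp continuous_tail).continuousOn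
      (mapsTo_univ _ _)).congr fun y hy => if_pos hy.2
  have hg₂ : RealOn A Z₂ g :=
    ((realOn_coord (continuous_const (y := x) (X := Unit))).comp
      (continuous_const (y := ())).continuousOn (mapsTo_univ _ _)).congr hgx
  have hg : RealOn A (sphere 0 1) g := by
    refine (hg₁.union hg₂ ?_ ?_).mono_right fun y hy => ?_
    · exact isClosed_sphere.inter (isClosed_eq (continuous_apply 0) continuous_const)
    · exact isClosed_sphere.inter ((isClosed_eq (continuous_apply 0) continuous_const).union
        (isClosed_eq continuous_tail.norm continuous_const))
    · have hy' : max |y 0| ‖Fin.tail y‖ = 1 := by rw [← norm_eq_max_tail]; simpa using hy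
      rcases max_choice |y 0| ‖Fin.tail y‖ with h | h
      · rcases (abs_eq zero_le_one).1 (h.symm.trans hy') with h | h
        · exact Or.inl ⟨hy, h⟩
        · exact Or.inr ⟨hy, Or.inl h⟩
      · exact Or.inr ⟨hy, Or.inr (h.symm.trans hy')⟩
  obtain ⟨G, hG, hGg⟩ := h g hg
  let κ : I × (Fin n → I) → Fin (n + 1) → ℝ := fun w => Fin.cons (1 - 2 * (w.1 : ℝ)) (ofCube w.2)
  have hκ : Continuous κ := Continuous.finCons (A := fun _ => ℝ) (by fun_prop)
    (continuous_ofCube.comp continuous_snd)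
  have habs : ∀ s : I, |1 - 2 * (s : ℝ)| ≤ 1 := fun s =>
    abs_le.2 ⟨by linarith [s.2.2], by linarith [s.2.1]⟩
  have hκm : MapsTo κ univ (closedBall 0 1) := fun w _ => by
    simpa [κ, norm_cons] using ⟨habs w.1, norm_ofCube_le w.2⟩
  obtain ⟨N, hN⟩ := exists_coord_eq (hG.comp hκ.continuousOn hκm)
  have hface : ∀ w, κ w ∈ Z₂ → N w = x := fun w hw => coord_injective (by
    rw [hN, hGg hw.1, hgx _ hw])
  have htail : ∀ w, Fin.tail (κ w) = ofCube w.2 := fun w => Fin.tail_cons _ _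
  have hside : ∀ w : I × (Fin n → I), w.2 ∈ Cube.boundary (Fin n) → N w = x := fun w hw => by
    have hw' := norm_ofCube_of_mem_boundary hw
    refine hface w ⟨?_, Or.inr ?_⟩
    · simp [κ, norm_cons, hw', habs]
    · rw [mem_ofPred_eq, htail, hw']
  have hzero : ∀ t, N (0, t) = f t := fun t => coord_injective (by
    have hs : κ (0, t) ∈ sphere (0 : Fin (n + 1) → ℝ) 1 := by
      simp [κ, norm_cons, norm_ofCube_le]
    rw [hN, hGg hs, show g (κ (0, t)) = _ from if_pos (by simp [κ]), htail, toCube_ofCube])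
  have hone : ∀ t, N (1, t) = x := fun t => hface _ ⟨by
    norm_num [κ, norm_cons, norm_ofCube_le], Or.inl (by norm_num [κ])⟩
  exact ⟨{ toContinuousMap := N
           map_zero_left := hzero
           map_one_left := hone
           prop' := fun s t ht => (hside (s, t) ht).trans (f.2 t ht).symm }⟩

end NerveRealization

section Squash

open Set Metric Topology unitInterval

variable {n : ℕ}

/-- A self-map of the cube `[-1, 1]ⁿ⁺¹` that collapses all its faces but one to a point. -/
noncomputable def squash (y : Fin (n + 1) → ℝ) : Fin (n + 1) → ℝ :=
  Fin.cons (1 - 2 * max ‖Fin.tail y‖ ((1 - y 0) / 2))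
    ((1 - max ‖Fin.tail y‖ ((1 - y 0) / 2)) • Fin.tail y)

lemma continuous_squash : Continuous (squash (n := n)) := by
  have h : Continuous fun y : Fin (n + 1) → ℝ => max ‖Fin.tail y‖ ((1 - y 0) / 2) :=
    continuous_tail.norm.max (by fun_prop)
  exact Continuous.finCons (A := fun _ => ℝ) (by fun_prop)
    ((continuous_const.sub h).smul continuous_tail)

lemma squash_eq {y : Fin (n + 1) → ℝ} (hy : ‖y‖ ≤ 1) (h : y 0 = -1 ∨ ‖Fin.tail y‖ = 1) :
    squash y = Fin.cons (-1) 0 := by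
  rw [norm_eq_max_tail, max_le_iff, abs_le] at hy
  have hr : max ‖Fin.tail y‖ ((1 - y 0) / 2) = 1 := by
    rcases h with h | h
    · rw [h, max_eq_right] <;> norm_num
      exact hy.2
    · rw [h, max_eq_left]
      linarith [hy.1.1]
  rw [squash, hr]
  norm_num

lemma squash_homotopy_ne_zero {y : Fin (n + 1) → ℝ} (hy : ‖y‖ = 1) {s : ℝ} (hs : s ∈ Icc (0 : ℝ) 1) :
    (1 - s) • y + s • squash y ≠ 0 := by
  intro h
  have hy' := hy
  rw [norm_eq_max_tail] at hy'
  have hle := max_le_iff.1 hy'.le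
  have h01 := abs_le.1 hle.1
  set r := max ‖Fin.tail y‖ ((1 - y 0) / 2) with hr
  have hr1 : r ≤ 1 := max_le hle.2 (by linarith)
  have hr0 : 0 ≤ r := (norm_nonneg _).trans (le_max_left _ _)
  have h0 : (1 - s) * y 0 + s * (1 - 2 * r) = 0 := by
    simpa [squash, hr] using congrFun h 0
  have hi : ∀ i : Fin n, (1 - s * r) * Fin.tail y i = 0 := fun i => by
    have := congrFun h i.succ
    simp only [Pi.add_apply, Pi.smul_apply, squash, Fin.cons_succ, smul_eq_mul, Pi.zero_apply,
      ← hr] at this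
    rw [← this, Fin.tail]
    ring
  by_cases hsr : s * r = 1
  · have hs1 : s = 1 := by nlinarith [hs.1, hs.2]
    have hr1' : r = 1 := by rw [hs1, one_mul] at hsr; exact hsr
    rw [hs1, hr1'] at h0
    norm_num at h0
  · have htail : Fin.tail y = 0 := funext fun i =>
      (mul_eq_zero.1 (hi i)).resolve_left (sub_ne_zero.2 (Ne.symm hsr))
    rw [htail, norm_zero, max_eq_left (abs_nonneg _)] at hy'
    rw [htail, norm_zero] at hr
    rcases (abs_eq zero_le_one).1 hy' with h' | h'
    · rw [hr, h'] at h0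
      norm_num at h0
    · rw [hr, h'] at h0
      norm_num at h0
      linarith

end Squash

namespace NerveRealization

open Set Metric Topology unitInterval

variable {T : Type} [PartialOrder T] {A : Set T} {n : ℕ}

lemma extProp_zero (h : Nonempty (Realization A)) : ExtProp A 0 := fun g _ =>
  h.elim fun x => ⟨fun _ => coord A x,
    (realOn_coord (continuous_const (y := x) (X := Unit))).comp
      (continuous_const (y := ())).continuousOn (mapsTo_univ _ _),
    fun y hy => absurd hy (by rw [Subsingleton.elim y 0, mem_sphere_zero_iff_norm, norm_zero]; simp)⟩

/-- If the homotopy groups vanish, then spheres extend to balls. -/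
lemma extProp_succ
    (h : ∀ x : Realization A, Subsingleton (HomotopyGroup (Fin n) (Realization A) x)) :
    ExtProp A (n + 1) := by
  intro g hg
  let κ : (Fin (n + 1) → ℝ) × ℝ → Fin (n + 1) → ℝ := fun w => (1 - w.2) • w.1 + w.2 • squash w.1
  have hκ : Continuous κ := by
    have := (continuous_squash (n := n)).comp
      (continuous_fst (X := Fin (n + 1) → ℝ) (Y := ℝ))
    exact ((continuous_const.sub continuous_snd).smul continuous_fst).add
      (continuous_snd.smul this)
  have hκ0 : ∀ w ∈ sphere (0 : Fin (n + 1) → ℝ) 1 ×ˢ Icc (0 : ℝ) 1, ‖κ w‖ ≠ 0 := fun w hw =>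
    norm_ne_zero_iff.2 (squash_homotopy_ne_zero (by simpa using hw.1) hw.2)
  let ν : (Fin (n + 1) → ℝ) × ℝ → Fin (n + 1) → ℝ := fun w => ‖κ w‖⁻¹ • κ w
  have hν : ContinuousOn ν (sphere 0 1 ×ˢ Icc 0 1) :=
    (hκ.norm.continuousOn.inv₀ hκ0).smul hκ.continuousOn
  have hνm : MapsTo ν (sphere 0 1 ×ˢ Icc 0 1) (sphere 0 1) := fun w hw => by
    simp [ν, norm_smul, hκ0 w hw]
  let g' : (Fin (n + 1) → ℝ) → T → ℝ := fun y => g (ν (y, 1))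
  have H : RealHtpy A (sphere 0 1) g g' := by
    refine ⟨fun w => g (ν w), hg.comp hν hνm, fun y hy => ?_, fun y _ => rfl⟩
    have hy' : ‖y‖ = 1 := by simpa using hy
    simp [ν, κ, hy']
  refine H.extendsToBall ?_
  let b : Fin (n + 1) → ℝ := Fin.cons (-1) 0
  have hb : ‖b‖ = 1 := by simp [b, norm_cons]
  have hg'b : ∀ y : Fin (n + 1) → ℝ, ‖y‖ = 1 → (y 0 = -1 ∨ ‖Fin.tail y‖ = 1) → g' y = g b := by
    intro y hy h
    simp [g', ν, κ, squash_eq hy.le h, b, norm_cons]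
  let τ : (Fin n → I) → Fin (n + 1) → ℝ := fun t => Fin.cons 1 (ofCube t)
  have hτn : ∀ t, ‖τ t‖ = 1 := fun t => by simp [τ, norm_cons, norm_ofCube_le]
  have hτ : Continuous τ := Continuous.finCons (A := fun _ => ℝ) continuous_const continuous_ofCube
  have hfreal : RealOn A univ fun t => g' (τ t) :=
    H.symm.left.comp hτ.continuousOn fun t _ => by simp [hτn]
  obtain ⟨f, hf⟩ := exists_coord_eq hfreal
  obtain ⟨x₀, hx₀⟩ := exists_coord_eq (hg.comp (continuous_const (X := Unit) (y := b)).continuousOn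
    (W := univ) fun _ _ => by simp [hb])
  let x := x₀ ()
  have hx : coord A x = g b := hx₀ ()
  have hloop : f ∈ GenLoop (Fin n) (Realization A) x := fun t ht => coord_injective (by
    rw [hf, hx, hg'b _ (hτn t)]
    right
    rw [show Fin.tail (τ t) = ofCube t from Fin.tail_cons _ _, norm_ofCube_of_mem_boundary ht])
  have := h x
  have hnull : GenLoop.Homotopic (⟨f, hloop⟩ : GenLoop (Fin n) (Realization A) x) GenLoop.const :=
    Quotient.exact (Subsingleton.elim (α := HomotopyGroup (Fin n) (Realization A) x) ⟦_⟧ ⟦_⟧)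
  obtain ⟨N⟩ := hnull
  let ρ : (Fin (n + 1) → ℝ) → I × (Fin n → I) := fun y =>
    (projIcc 0 1 zero_le_one ((1 - y 0) / 2), toCube (Fin.tail y))
  have hρ : Continuous ρ := (continuous_projIcc.comp (by fun_prop)).prodMk
    (continuous_toCube.comp continuous_tail)
  refine ⟨fun y => coord A (N (ρ y)), (realOn_coord N.continuous).comp hρ.continuousOn
    (mapsTo_univ _ _), fun y hy => ?_⟩
  have hy' : ‖y‖ = 1 := by simpa using hy
  have hmax := hy'
  rw [norm_eq_max_tail] at hmax
  have htail : ‖Fin.tail y‖ ≤ 1 := (max_le_iff.1 hmax.le).2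
  have hside : ‖Fin.tail y‖ = 1 → coord A (N (ρ y)) = g' y := fun hs => by
    have hmem := toCube_mem_boundary hs
    have hN : N (ρ y) = x := (N.eq_fst _ hmem).trans (hloop _ hmem)
    rw [hN, hx, hg'b y hy' (Or.inr hs)]
  rcases max_choice |y 0| ‖Fin.tail y‖ with hm | hm
  · rcases (abs_eq zero_le_one).1 (hm.symm.trans hmax) with h0 | h0
    · have hρy : ρ y = (0, toCube (Fin.tail y)) := by simp [ρ, h0]
      have hτy : τ (toCube (Fin.tail y)) = y := by
        simp only [τ]
        rw [ofCube_toCube htail, ← h0, Fin.cons_self_tail]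
      calc coord A (N (ρ y)) = coord A (f (toCube (Fin.tail y))) := by
            rw [hρy, N.apply_zero]
        _ = g' y := by rw [hf, hτy]
    · have hρy : ρ y = (1, toCube (Fin.tail y)) := by
        have : (1 - y 0) / 2 = 1 := by rw [h0]; norm_num
        simp [ρ, this]
      calc coord A (N (ρ y)) = coord A x := by
            rw [hρy, N.apply_one]
            rfl
        _ = g' y := by rw [hx, hg'b y hy' (Or.inl h0)]
  · exact hside (hm.symm.trans hmax)

end NerveRealization

section Connectivity

variable {V : Type}

open NerveRealization

lemma SetDConnected.extProp {A : Set (OSeq V)} {d : ℤ} (h : SetDConnected A d) {k : ℕ}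
    (hk : (k : ℤ) ≤ d + 1) : ExtProp A k := by
  obtain ⟨hne, hπ⟩ := h.resolve_left (by omega)
  cases k with
  | zero => exact extProp_zero hne
  | succ n => exact extProp_succ (hπ n (by omega))

lemma setDConnected_of_extProp {A : Set (OSeq V)} {d : ℤ} (hne : A.Nonempty)
    (h : ∀ n : ℕ, (n : ℤ) ≤ d → ExtProp A (n + 1)) : SetDConnected A d := by
  refine Or.inr ⟨?_, fun n hn x => subsingleton_homotopyGroup (h n hn) x⟩
  obtain ⟨p, hp⟩ := hne
  obtain ⟨z, -⟩ := exists_weight_eq (isBarycentric_single (⟨p, hp⟩ : A))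
  exact ⟨z⟩

end Connectivity

/-- (Lemma 2.13 (2)) Let `F ⊆ U(M^∞)` satisfy the chain condition and let
`X ⊆ M^∞`. If for every `(v_1, …, v_m) ∈ F \ O(X)` the poset `O(X) ∩ F_{(v_1, …, v_m)}` is
`(d − m + 1)`-connected, and there is a sequence `(y_0)` of length one in `F` with
`O(X) ∩ F ⊆ F_{(y_0)}`, then `F` is `(d+1)`-connected. -/
theorem chainLemma_two (R : Type) [Ring R] (M : Type) [AddCommGroup M] [Module Rᵐᵒᵖ M]
    (F : Set (OSeq (MInf R M))) (X : Set (MInf R M)) (d : ℤ)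
    (hFU : F ⊆ UnimodSeqs R (MInf R M))
    (hchain : ChainCondition F)
    (h2 : ∀ v ∈ F, v ∉ SeqIn X →
      SetDConnected (SeqIn X ∩ SeqExt F v) (d - v.1.length + 1))
    (h3 : ∃ y : OSeq (MInf R M), y.1.length = 1 ∧ y ∈ F ∧ (SeqIn X ∩ F) ⊆ SeqExt F y) :
    SetDConnected F (d + 1) := by
  obtain ⟨y, -, hy, hXy⟩ := h3
  refine setDConnected_of_extProp ⟨y, hy⟩ fun n hn => ?_
  exact extProp_of_links hchain (fun v hv hvX k hk => (h2 v hv hvX).extProp (by omega)) hy hXy
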